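/- Let A = ℂQ/⟨R⟩ be a connected, acyclic, tame bound quiver algebra and let α ∈ ℕ^{Q_0} be a dimension vector with P_A(α) ≠ ∅. If C(α) is an indecomposable irreducible component of mod(A,α), then ext^1_A(C(α), C(α)) = 0. -/

import Mathlib

open Matrix
noncomputable section

/-- A (finite-vertex) quiver: vertices, arrows, tail and head maps. -/
structure Quiv where
  V : Type
  A : Type
  t : A → V
  h : A → V
  [fV : Fintype V]
  [dV : DecidableEq V]

attribute [instance] Quiv.fV Quiv.dV

/-- The `Quiver` structure on the vertices of `Q`: an arrow from `x` to `y` is an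
arrow of `Q` with tail `x` and head `y`.  This gives us `Quiver.Path x y`, the type of
oriented paths from `x` to `y` in `Q`. -/
instance quivToQuiver (Q : Quiv) : Quiver Q.V := ⟨fun x y => {a : Q.A // Q.t a = x ∧ Q.h a = y}⟩

/-- The space of matrix representations of `Q` of dimension vector `β`, with entries in a
commutative ring `R`. -/
def RepR (Q : Quiv) (R : Type) (β : Q.V → ℕ) := ∀ a : Q.A, Matrix (Fin (β (Q.h a))) (Fin (β (Q.t a))) R

/-- The representation space `rep(Q,β) = ∏_{a ∈ Q₁} ℂ^{β(ha) × β(ta)}`. -/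
abbrev QRep (Q : Quiv) (β : Q.V → ℕ) := RepR Q ℂ β

/-- Transport of a rectangular matrix along equalities of its sizes. -/
def castM {R : Type} {m n m' n' : ℕ} (hm : m = m') (hn : n = n')
    (M : Matrix (Fin m) (Fin n) R) : Matrix (Fin m') (Fin n') R :=
  M.submatrix (Fin.cast hm.symm) (Fin.cast hn.symm)

/-- The value `W(p)` of a representation `W` on an oriented path `p` (the product of the
matrices attached to the arrows of `p`; the trivial path gives the identity matrix). -/
def evalPath {Q : Quiv} {R : Type} [CommRing R] {β : Q.V → ℕ} (W : RepR Q R β) :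
    ∀ {x y : Q.V}, Quiver.Path x y → Matrix (Fin (β y)) (Fin (β x)) R
  | _, _, Quiver.Path.nil => 1
  | _, _, Quiver.Path.cons p e =>
      (castM (congrArg β e.2.2) (congrArg β e.2.1) (W e.1)) * evalPath W p
variable (Q : Quiv)

/-- A formal (finite) linear combination of parallel oriented paths in `Q`, together with its
endpoints: the element of the path algebra it represents lives in `e_y · ℂQ · e_x`. -/
def FormalRel := Σ (x : Q.V) (y : Q.V), (Quiver.Path x y →₀ ℂ)

variable {Q}

/-- Evaluation of a representation on a formal linear combination of parallel paths. -/
def evalLin {β : Q.V → ℕ} (W : QRep Q β) {x y : Q.V} (c : Quiver.Path x y →₀ ℂ) :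
    Matrix (Fin (β y)) (Fin (β x)) ℂ :=
  c.sum fun p k => k • evalPath W p

/-- Evaluation of a representation over `ℂ[x]` on a formal linear combination of paths. -/
def evalLinP {β : Q.V → ℕ} (W : RepR Q (Polynomial ℂ) β) {x y : Q.V}
    (c : Quiver.Path x y →₀ ℂ) : Matrix (Fin (β y)) (Fin (β x)) (Polynomial ℂ) :=
  c.sum fun p k => (Polynomial.C k) • evalPath W p

/-- The module variety `mod(A,β)` of the algebra `A = ℂQ/⟨S⟩`: all `β`-dimensional
representations of `Q` annihilating every relation in `S`. -/
def modSet (S : Set (FormalRel Q)) (β : Q.V → ℕ) : Set (QRep Q β) :=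
  {W | ∀ r ∈ S, evalLin W r.2.2 = 0}

/-- A set of relations is admissible if every path occurring in it has length at least two. -/
def AdmissibleRels (S : Set (FormalRel Q)) : Prop :=
  ∀ r ∈ S, ∀ p ∈ r.2.2.support, 2 ≤ p.length

/-- The base change group `GL(β) = ∏_x GL(β(x),ℂ)`. -/
abbrev GLb (β : Q.V → ℕ) := ∀ x : Q.V, Matrix.GeneralLinearGroup (Fin (β x)) ℂ

/-- The action of `GL(β)` on `rep(Q,β)` by simultaneous conjugation. -/
def gAct {β : Q.V → ℕ} (g : GLb β) (W : QRep Q β) : QRep Q β :=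
  fun a => ((g (Q.h a)).val) * W a * (((g (Q.t a))⁻¹).val)

/-- The character of `GL(β)` induced by the weight `σ`: `g ↦ ∏_x det(g(x))^{σ(x)}`.  -/
def chi {β : Q.V → ℕ} (σ : Q.V → ℤ) (g : GLb β) : ℂ :=
  ∏ x : Q.V, ((g x).val.det) ^ (σ x)

/-- Index type of the coordinates on `rep(Q,β)`. -/
def RepCoord (β : Q.V → ℕ) := Σ a : Q.A, Fin (β (Q.h a)) × Fin (β (Q.t a))

/-- The coordinates of a point of `rep(Q,β)`. -/
def repCoords {β : Q.V → ℕ} (W : QRep Q β) : RepCoord (Q := Q) β → ℂ :=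
  fun c => W c.1 c.2.1 c.2.2

/-- `F` is a polynomial function on `rep(Q,β)`. -/
def IsPolyFun {β : Q.V → ℕ} (F : QRep Q β → ℂ) : Prop :=
  ∃ P : MvPolynomial (RepCoord (Q := Q) β) ℂ, ∀ W, F W = MvPolynomial.eval (repCoords W) P

/-- `F` is a semi-invariant of weight `σ` on `rep(Q,β)`. -/
def IsSemiInvariant {β : Q.V → ℕ} (σ : Q.V → ℤ) (F : QRep Q β → ℂ) : Prop :=
  IsPolyFun F ∧ ∀ (g : GLb β) (W : QRep Q β), F (gAct g W) = chi σ g * F W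

/-- The orbit semigroup `S_Q(W)` of a representation `W ∈ rep(Q,β)`: all weights `σ` admitting
a semi-invariant of weight `σ` not vanishing at `W`. -/
def OrbitSemigroup {β : Q.V → ℕ} (W : QRep Q β) : Set (Q.V → ℤ) :=
  {σ | ∃ F : QRep Q β → ℂ, IsSemiInvariant σ F ∧ F W ≠ 0}

/-- `W` is `σ`-semi-stable: some positive multiple of `σ` lies in the orbit semigroup. -/
def SemiStable {β : Q.V → ℕ} (σ : Q.V → ℤ) (W : QRep Q β) : Prop :=
  ∃ n : ℕ, 1 ≤ n ∧ (fun x => (n : ℤ) * σ x) ∈ OrbitSemigroup W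

/-- The weight `σ` is `W`-saturated: if `nσ` lies in the orbit semigroup of `W` for some
integer `n ≥ 1`, then so does `σ`. -/
def WSaturated {β : Q.V → ℕ} (W : QRep Q β) (σ : Q.V → ℤ) : Prop :=
  (∃ n : ℕ, 1 ≤ n ∧ (fun x => (n : ℤ) * σ x) ∈ OrbitSemigroup W) → σ ∈ OrbitSemigroup W

/-- `Q` is connected: any two vertices are joined by an unoriented walk. -/
def QConnected (Q : Quiv) : Prop :=
  ∀ x y : Q.V, Relation.ReflTransGen
    (fun u v => ∃ a : Q.A, (Q.t a = u ∧ Q.h a = v) ∨ (Q.t a = v ∧ Q.h a = u)) x y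

/-- `Q` is acyclic: the only oriented path from a vertex to itself is the trivial one. -/
def QAcyclic (Q : Quiv) : Prop := ∀ (x : Q.V) (p : Quiver.Path x x), p = Quiver.Path.nil
section Capacity

variable (Q : Quiv) (β : Q.V → ℕ) (σ : Q.V → ℤ)

/-- Vertices where the weight `σ` is positive. -/
abbrev PosV := {x : Q.V // 0 < σ x}

/-- Vertices where the weight `σ` is negative. -/
abbrev NegV := {x : Q.V // σ x < 0}

/-- `σ₊` at a positive vertex. -/
abbrev posP (i : PosV Q σ) : ℕ := (σ i.1).toNat

/-- `σ₋` at a negative vertex. -/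
abbrev negP (j : NegV Q σ) : ℕ := (-σ j.1).toNat

/-- Row index type of the `N × N` block matrices: block rows are indexed by pairs `(j,q)`
with `q ∈ I_j⁻`, each of height `β(w_j)`; so `N = Σ_j σ₋(w_j)β(w_j)` rows in total. -/
abbrev RowT := Σ j : NegV Q σ, Fin (negP Q σ j) × Fin (β j.1)

/-- Column index type of the `N × N` block matrices: block columns indexed by pairs `(i,r)`
with `r ∈ I_i⁺`, each of width `β(v_i)`; so `N = Σ_i σ₊(v_i)β(v_i)` columns in total. -/
abbrev ColT := Σ i : PosV Q σ, Fin (posP Q σ i) × Fin (β i.1)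

/-- The index set `I_σ = {(i,j,p,q,r)}`. -/
structure BIdx where
  i : PosV Q σ
  j : NegV Q σ
  p : Quiver.Path i.1 j.1
  q : Fin (negP Q σ j)
  r : Fin (posP Q σ i)

variable {Q β σ}

/-- The block matrix `W^{i,j,p}_{q,r}`: its `(q,r)` block entry is `W(p)` and all other
entries vanish. -/
def blockMat (W : QRep Q β) (d : BIdx Q σ) : Matrix (RowT Q β σ) (ColT Q β σ) ℂ :=
  fun s u =>
    if hj : s.1 = d.j then
      if hi : u.1 = d.i then
        if Fin.cast (congrArg (negP Q σ) hj) s.2.1 = d.q ∧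
           Fin.cast (congrArg (posP Q σ) hi) u.2.1 = d.r then
          evalPath W d.p (Fin.cast (congrArg (fun z => β z.1) hj) s.2.2)
            (Fin.cast (congrArg (fun z => β z.1) hi) u.2.2)
        else 0
      else 0
    else 0

/-- The Brascamp–Lieb (completely positive) operator `T_{W,σ}` associated to the quiver
datum `(W,σ)`, with Kraus operators the block matrices `W^{i,j,p}_{q,r}`. -/
def BLop (W : QRep Q β) (X : Matrix (RowT Q β σ) (RowT Q β σ) ℂ) :
    Matrix (ColT Q β σ) (ColT Q β σ) ℂ :=
  ∑ᶠ d : BIdx Q σ, (blockMat W d)ᵀ * X * blockMat W d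

/-- The capacity `cap_Q(W,σ)` of the quiver datum `(W,σ)`: the infimum of
`Det (T_{W,σ}(X))` over real positive definite matrices `X` with `Det X = 1`. -/
def capQ (W : QRep Q β) : ℝ :=
  sInf {r : ℝ | ∃ X : Matrix (RowT Q β σ) (RowT Q β σ) ℝ, X.PosDef ∧ X.det = 1 ∧
    r = ((BLop (σ := σ) W (X.map Complex.ofReal)).det).re}

/-- `Span_ℂ(W^{i,j,p}_{q,r} : (i,j,p,q,r) ∈ I_σ)` contains a non-singular `N × N` matrix. -/
def SpanNonsingular (W : QRep Q β) (σ : Q.V → ℤ) : Prop :=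
  ∃ M ∈ Submodule.span ℂ (Set.range (blockMat (σ := σ) W)),
    Function.Bijective (Matrix.mulVecLin M)

end Capacity
section HomExt

variable {Q : Quiv}

/-- The space of morphisms of representations `Hom(V,W)`, as a subspace of
`∏_x Hom(V(x),W(x))` (in matrix form). -/
def HomS {α γ : Q.V → ℕ} (V : QRep Q α) (W : QRep Q γ) :
    Submodule ℂ (∀ x : Q.V, Matrix (Fin (γ x)) (Fin (α x)) ℂ) where
  carrier := {φ | ∀ a : Q.A, φ (Q.h a) * V a = W a * φ (Q.t a)}
  add_mem' := by
    intro φ ψ hφ hψ a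
    simp only [Pi.add_apply, Matrix.add_mul, Matrix.mul_add, hφ a, hψ a]
  zero_mem' := by intro a; simp
  smul_mem' := by
    intro c φ hφ a
    simp only [Pi.smul_apply, Matrix.smul_mul, Matrix.mul_smul, hφ a]

/-- `dim_ℂ Hom(V,W)`. -/
def dimHom {α γ : Q.V → ℕ} (V : QRep Q α) (W : QRep Q γ) : ℕ :=
  Module.finrank ℂ (HomS V W)

/-- A family of matrices is componentwise surjective (as linear maps). -/
def MorSurj {α γ : Q.V → ℕ} (φ : ∀ x : Q.V, Matrix (Fin (γ x)) (Fin (α x)) ℂ) : Prop :=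
  ∀ x, Function.Surjective (Matrix.mulVecLin (φ x))

/-- A family of matrices is componentwise injective (as linear maps). -/
def MorInj {α γ : Q.V → ℕ} (φ : ∀ x : Q.V, Matrix (Fin (γ x)) (Fin (α x)) ℂ) : Prop :=
  ∀ x, Function.Injective (Matrix.mulVecLin (φ x))

/-- Isomorphism of representations (possibly of different dimension vectors). -/
def RIso {α γ : Q.V → ℕ} (V : QRep Q α) (W : QRep Q γ) : Prop :=
  ∃ u : ∀ x : Q.V, ((Fin (α x) → ℂ) ≃ₗ[ℂ] (Fin (γ x) → ℂ)),
    ∀ a : Q.A, (u (Q.h a)).toLinearMap ∘ₗ (V a).mulVecLin =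
      (W a).mulVecLin ∘ₗ (u (Q.t a)).toLinearMap

/-- The space of `1`-cochains from `V` to `W`: families `φ(a) : V(ta) → W(ha)`. -/
abbrev C1sp (α γ : Q.V → ℕ) := ∀ a : Q.A, Matrix (Fin (γ (Q.h a))) (Fin (α (Q.t a))) ℂ

/-- The derivative (Leibniz rule) of a path with respect to a `1`-cochain `φ`:
`D_{a_s ⋯ a_1}(φ) = Σ_k W(a_s ⋯ a_{k+1}) φ(a_k) V(a_{k-1} ⋯ a_1)`. -/
def der {α γ : Q.V → ℕ} (V : QRep Q α) (W : QRep Q γ) (φ : C1sp (Q := Q) α γ) :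
    ∀ {x y : Q.V}, Quiver.Path x y → Matrix (Fin (γ y)) (Fin (α x)) ℂ
  | _, _, Quiver.Path.nil => 0
  | _, _, Quiver.Path.cons p e =>
      castM (congrArg γ e.2.2) (congrArg α e.2.1) (φ e.1) * evalPath V p
      + castM (congrArg γ e.2.2) (congrArg γ e.2.1) (W e.1) * der V W φ p

lemma der_add {α γ : Q.V → ℕ} (V : QRep Q α) (W : QRep Q γ) (φ ψ : C1sp (Q := Q) α γ)
    {x y : Q.V} (p : Quiver.Path x y) :
    der V W (φ + ψ) p = der V W φ p + der V W ψ p := by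
  induction p with
  | nil => simp [der]
  | cons p e ih =>
      simp only [der, ih, Pi.add_apply, castM, Matrix.submatrix_add, Matrix.add_mul,
        Matrix.mul_add]
      abel

lemma der_smul {α γ : Q.V → ℕ} (V : QRep Q α) (W : QRep Q γ) (c : ℂ) (φ : C1sp (Q := Q) α γ)
    {x y : Q.V} (p : Quiver.Path x y) :
    der V W (c • φ) p = c • der V W φ p := by
  induction p with
  | nil => simp [der]
  | cons p e ih =>
      simp only [der, ih, Pi.smul_apply, castM, Matrix.submatrix_smul, Matrix.smul_mul,
        Matrix.mul_smul, smul_add]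

lemma der_zero {α γ : Q.V → ℕ} (V : QRep Q α) (W : QRep Q γ)
    {x y : Q.V} (p : Quiver.Path x y) :
    der V W (0 : C1sp (Q := Q) α γ) p = 0 := by
  induction p with
  | nil => simp [der]
  | cons p e ih =>
      simp [der, ih, castM]

/-- The derivative of a formal linear combination of parallel paths. -/
def derRel {α γ : Q.V → ℕ} (V : QRep Q α) (W : QRep Q γ) (φ : C1sp (Q := Q) α γ)
    {x y : Q.V} (c : Quiver.Path x y →₀ ℂ) : Matrix (Fin (γ y)) (Fin (α x)) ℂ :=
  c.sum fun p k => k • der V W φ p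

/-- The space of `1`-cocycles relative to the set of relations `S`: cochains whose
derivative kills every relation in `S`. -/
def Z1 (S : Set (FormalRel Q)) {α γ : Q.V → ℕ} (V : QRep Q α) (W : QRep Q γ) :
    Submodule ℂ (C1sp (Q := Q) α γ) where
  carrier := {φ | ∀ r ∈ S, derRel V W φ r.2.2 = 0}
  add_mem' := by
    intro φ ψ hφ hψ r hr
    have : derRel V W (φ + ψ) r.2.2 = derRel V W φ r.2.2 + derRel V W ψ r.2.2 := by
      simp only [derRel, der_add, smul_add]
      exact Finsupp.sum_add
    rw [this, hφ r hr, hψ r hr, add_zero]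
  zero_mem' := by
    intro r hr
    simp [derRel, der_zero]
  smul_mem' := by
    intro c φ hφ r hr
    have : derRel V W (c • φ) r.2.2 = c • derRel V W φ r.2.2 := by
      simp only [derRel, der_smul, Finsupp.smul_sum, smul_comm c]
    rw [this, hφ r hr, smul_zero]

/-- The coboundary map `d⁰ : ∏_x Hom(V(x),W(x)) → C¹`,
`f ↦ (a ↦ f(ha) V(a) − W(a) f(ta))`. -/
def d0map {α γ : Q.V → ℕ} (V : QRep Q α) (W : QRep Q γ) :
    (∀ x : Q.V, Matrix (Fin (γ x)) (Fin (α x)) ℂ) →ₗ[ℂ] C1sp (Q := Q) α γ where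
  toFun f := fun a => f (Q.h a) * V a - W a * f (Q.t a)
  map_add' f g := by
    funext a
    simp only [Pi.add_apply, Matrix.add_mul, Matrix.mul_add]
    abel
  map_smul' c f := by
    funext a
    simp only [Pi.smul_apply, Matrix.smul_mul, Matrix.mul_smul, smul_sub, RingHom.id_apply]

/-- The space of `1`-coboundaries. -/
def B1 {α γ : Q.V → ℕ} (V : QRep Q α) (W : QRep Q γ) : Submodule ℂ (C1sp (Q := Q) α γ) :=
  LinearMap.range (d0map V W)

/-- `dim_ℂ Ext¹(V,W)` over the algebra `ℂQ/⟨S⟩`, computed as the dimension of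
`Z¹/B¹` (for modules, `B¹ ⊆ Z¹`, so this is `dim Z¹ − dim B¹`). -/
def dimExt1 (S : Set (FormalRel Q)) {α γ : Q.V → ℕ} (V : QRep Q α) (W : QRep Q γ) : ℕ :=
  Module.finrank ℂ (Z1 S V W) - Module.finrank ℂ ↥((B1 V W) ⊓ (Z1 S V W))

end HomExt
section ProjPdim

variable {Q : Quiv}

/-- `P` is a projective module over `ℂQ/⟨S⟩` (in matrix-representation form):
every morphism from `P` to the target of a surjection of modules lifts. -/
def IsProjRep (S : Set (FormalRel Q)) {γ : Q.V → ℕ} (P : QRep Q γ) : Prop :=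
  ∀ (δ ε : Q.V → ℕ) (M : QRep Q δ) (N : QRep Q ε), M ∈ modSet S δ → N ∈ modSet S ε →
    ∀ g ∈ HomS M N, MorSurj g → ∀ f ∈ HomS P N,
      ∃ h ∈ HomS P M, ∀ x, g x * h x = f x

/-- `V` has projective dimension at most one over `ℂQ/⟨S⟩`: there is a short exact
sequence `0 → P₁ → P₀ → V → 0` with `P₀, P₁` projective. -/
def PdimLE1 (S : Set (FormalRel Q)) {β : Q.V → ℕ} (V : QRep Q β) : Prop :=
  ∃ (γ₀ γ₁ : Q.V → ℕ) (P₀ : QRep Q γ₀) (P₁ : QRep Q γ₁),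
    P₀ ∈ modSet S γ₀ ∧ P₁ ∈ modSet S γ₁ ∧ IsProjRep S P₀ ∧ IsProjRep S P₁ ∧
    ∃ i ∈ HomS P₁ P₀, ∃ p ∈ HomS P₀ V, MorInj i ∧ MorSurj p ∧
      ∀ x, LinearMap.range (Matrix.mulVecLin (i x)) = LinearMap.ker (Matrix.mulVecLin (p x))

/-- The set `P_A(α) = {V ∈ mod(A,α) : pdim_A V ≤ 1}` where `A = ℂQ/⟨S⟩`. -/
def PAset (S : Set (FormalRel Q)) (α : Q.V → ℕ) : Set (QRep Q α) :=
  {V | V ∈ modSet S α ∧ PdimLE1 S V}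

end ProjPdim

section Zariski

/-- The Zariski topology on the affine space `ι → ℂ`: generated by the complements of
hypersurfaces. -/
def zarPi (ι : Type) : TopologicalSpace (ι → ℂ) :=
  TopologicalSpace.generateFrom
    {U | ∃ p : MvPolynomial ι ℂ, U = {w | MvPolynomial.eval w p ≠ 0}}

variable {Q : Quiv}

/-- The Zariski topology on `rep(Q,β)`. -/
def zarTop (β : Q.V → ℕ) : TopologicalSpace (QRep Q β) :=
  TopologicalSpace.induced (repCoords (β := β)) (zarPi _)

/-- Zariski closure in `rep(Q,β)`. -/
def zclosure {β : Q.V → ℕ} (s : Set (QRep Q β)) : Set (QRep Q β) :=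
  @closure _ (zarTop β) s

/-- Zariski-open. -/
def zIsOpen {β : Q.V → ℕ} (s : Set (QRep Q β)) : Prop := @IsOpen _ (zarTop β) s

/-- Zariski-closed. -/
def zIsClosed {β : Q.V → ℕ} (s : Set (QRep Q β)) : Prop := @IsClosed _ (zarTop β) s

/-- Irreducibility in the Zariski topology. -/
def zIrred {β : Q.V → ℕ} (s : Set (QRep Q β)) : Prop := @IsIrreducible _ (zarTop β) s

/-- Dimension of a subset of `rep(Q,β)`: the topological Krull dimension in the
(subspace) Zariski topology. -/
def zdim {β : Q.V → ℕ} (s : Set (QRep Q β)) : WithBot ℕ∞ :=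
  @topologicalKrullDim s (TopologicalSpace.induced Subtype.val (zarTop β))

/-- `C(α)`: the closure of `P_A(α)`. -/
def Cset (S : Set (FormalRel Q)) (α : Q.V → ℕ) : Set (QRep Q α) := zclosure (PAset S α)

/-- `C` is an irreducible component of `M` (for `M` closed in `rep(Q,α)`): a maximal
irreducible closed subset of `M`. -/
def IsIrrCompOf {β : Q.V → ℕ} (C M : Set (QRep Q β)) : Prop :=
  zIrred C ∧ zIsClosed C ∧ C ⊆ M ∧
    ∀ C' : Set (QRep Q β), zIrred C' → zIsClosed C' → C' ⊆ M → C ⊆ C' → C' = C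

/-- `V` is an indecomposable representation: it is nonzero and its endomorphism algebra
has no idempotents other than `0` and `1`. -/
def IsIndecRep {α : Q.V → ℕ} (V : QRep Q α) : Prop :=
  (∃ x, α x ≠ 0) ∧
  ∀ φ ∈ HomS V V, (∀ x, φ x * φ x = φ x) → φ = 0 ∨ φ = fun x => (1 : Matrix _ _ ℂ)

/-- `C` is an indecomposable irreducible component of `M`: an irreducible component
containing a dense open subset of indecomposable representations. -/
def IsIndecComp {β : Q.V → ℕ} (C M : Set (QRep Q β)) : Prop :=
  IsIrrCompOf C M ∧
  ∃ U : Set (QRep Q β), zIsOpen U ∧ C ⊆ zclosure (C ∩ U) ∧ ∀ V ∈ C ∩ U, IsIndecRep V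

/-- The `GL(α)`-orbit of `V`. -/
def orbitOf {α : Q.V → ℕ} (V : QRep Q α) : Set (QRep Q α) := {W | ∃ g : GLb α, gAct g V = W}

/-- `C` is an orbit closure `closure(GL(α)·V)` of some module `V ∈ mod(A,α)`. -/
def IsOrbitClosure (S : Set (FormalRel Q)) {α : Q.V → ℕ} (C : Set (QRep Q α)) : Prop :=
  ∃ V ∈ modSet S α, C = zclosure (orbitOf V)

/-- The coordinates on `∏_x ℂ^{α(x) × α(x)}`, the ambient space of `GL(α)`. -/
def glCoords {α : Q.V → ℕ} (g : ∀ x : Q.V, Matrix (Fin (α x)) (Fin (α x)) ℂ) :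
    (Σ x : Q.V, Fin (α x) × Fin (α x)) → ℂ := fun c => g c.1 c.2.1 c.2.2

/-- The Zariski topology on `∏_x ℂ^{α(x) × α(x)}`. -/
def glTop (Q : Quiv) (α : Q.V → ℕ) :
    TopologicalSpace (∀ x : Q.V, Matrix (Fin (α x)) (Fin (α x)) ℂ) :=
  TopologicalSpace.induced glCoords (zarPi _)

/-- `GL(α)` as a (quasi-affine) subset of `∏_x ℂ^{α(x) × α(x)}`. -/
def glSet (Q : Quiv) (α : Q.V → ℕ) : Set (∀ x : Q.V, Matrix (Fin (α x)) (Fin (α x)) ℂ) :=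
  {g | ∀ x, IsUnit (g x)}

/-- The dimension of the group variety `GL(α)`. -/
def glDim (Q : Quiv) (α : Q.V → ℕ) : WithBot ℕ∞ :=
  @topologicalKrullDim (glSet Q α) (TopologicalSpace.induced Subtype.val (glTop Q α))

end Zariski
section Sums

variable {Q : Quiv}

/-- `W` is a direct sum of the representations `V i` (up to isomorphism of the underlying
block-diagonal structure). -/
def IsSumOf {ι : Type} [Fintype ι] [DecidableEq ι] {αs : ι → Q.V → ℕ} {δ : Q.V → ℕ}
    (W : QRep Q δ) (V : ∀ i, QRep Q (αs i)) : Prop :=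
  ∃ u : ∀ x : Q.V, ((Fin (δ x) → ℂ) ≃ₗ[ℂ] ((Σ i, Fin (αs i x)) → ℂ)),
    ∀ a : Q.A, (u (Q.h a)).toLinearMap ∘ₗ (W a).mulVecLin =
      (Matrix.blockDiagonal' (fun i => V i a)).mulVecLin ∘ₗ (u (Q.t a)).toLinearMap

/-- The constructible subset `C₁ ⊕ ⋯ ⊕ C_l ⊆ rep(Q,δ)`: representations isomorphic to a
direct sum `V₁ ⊕ ⋯ ⊕ V_l` with `V_i ∈ C_i`. -/
def sumSet {ι : Type} [Fintype ι] [DecidableEq ι] (αs : ι → Q.V → ℕ)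
    (Cs : ∀ i, Set (QRep Q (αs i))) (δ : Q.V → ℕ) : Set (QRep Q δ) :=
  {W | ∃ V : ∀ i, QRep Q (αs i), (∀ i, V i ∈ Cs i) ∧ IsSumOf W V}

/-- The generic `Ext¹` between two subsets:
`ext¹(C,D) = min {dim Ext¹(X,Y) : (X,Y) ∈ C × D}`. -/
def genExt1 (S : Set (FormalRel Q)) {α α' : Q.V → ℕ}
    (C : Set (QRep Q α)) (D : Set (QRep Q α')) : ℕ :=
  sInf {n : ℕ | ∃ X ∈ C, ∃ Y ∈ D, n = dimExt1 S X Y}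

end Sums

section ExtHigher

variable {Q : Quiv}

/-- A representation of `Q` packaged with its dimension vector. -/
def PRp (Q : Quiv) := Σ γ : Q.V → ℕ, QRep Q γ

instance : Inhabited (PRp Q) := ⟨⟨fun _ => 0, fun _ => 0⟩⟩

/-- `K` is a (first) syzygy of `M` over `ℂQ/⟨S⟩`: there is a short exact sequence
`0 → K → P → M → 0` with `P` a projective module. -/
def IsSyzOf (S : Set (FormalRel Q)) (K M : PRp Q) : Prop :=
  K.2 ∈ modSet S K.1 ∧ ∃ (γP : Q.V → ℕ) (P : QRep Q γP), P ∈ modSet S γP ∧ IsProjRep S P ∧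
    ∃ i ∈ HomS K.2 P, ∃ p ∈ HomS P M.2, MorInj i ∧ MorSurj p ∧
      ∀ x, LinearMap.range (Matrix.mulVecLin (i x)) = LinearMap.ker (Matrix.mulVecLin (p x))

/-- A chosen syzygy of `M` over `ℂQ/⟨S⟩`. -/
def syz (S : Set (FormalRel Q)) (M : PRp Q) : PRp Q :=
  Classical.epsilon (fun K => IsSyzOf S K M)

/-- `dim_ℂ Ext^l (M,N)` over `ℂQ/⟨S⟩`, via dimension shifting along syzygies:
`Ext⁰ = Hom`, `Ext¹` is computed by cochains, and `Ext^{l+2}(M,N) = Ext^{l+1}(ΩM,N)`. -/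
def dimExtN (S : Set (FormalRel Q)) : ℕ → PRp Q → PRp Q → ℕ
  | 0, M, N => dimHom M.2 N.2
  | 1, M, N => dimExt1 S M.2 N.2
  | (l+2), M, N => dimExtN S (l+1) (syz S M) N

/-- The simple representation `S_x` concentrated at the vertex `x`. -/
def simplePR (Q : Quiv) (x0 : Q.V) : PRp Q :=
  ⟨fun z => if z = x0 then 1 else 0, fun _ => 0⟩

/-- The Euler form pairing `⟨α, dim S_y⟩_B` of the algebra `B = ℂQ/⟨S⟩`:
`Σ_{l ≥ 0} (−1)^l Σ_x dim Ext^l_B(S_x,S_y) · α(x)`.  The weight `⟨α,−⟩_B` is the function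
`y ↦ eulerPair S α y`. -/
def eulerPair (S : Set (FormalRel Q)) (α : Q.V → ℕ) (y : Q.V) : ℤ :=
  ∑ᶠ l : ℕ, (-1 : ℤ)^l *
    ∑ x : Q.V, (α x : ℤ) * (dimExtN S l (simplePR Q x) (simplePR Q y) : ℤ)

/-- The set of relations annihilating `W`: the annihilator `Ann_{ℂQ}(W)`, so that
`B = ℂQ/Ann_{ℂQ}(W)`. -/
def annRel {β : Q.V → ℕ} (W : QRep Q β) : Set (FormalRel Q) :=
  {r | evalLin W r.2.2 = 0}

/-- The weight semigroup `L_W` of `W`: weights `σ` with `σ|_{supp β} = ⟨α,−⟩_B` for some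
dimension vector `α ∈ ℕ^{supp β}` with `P_B(α) ≠ ∅`, where `B = ℂQ/Ann_{ℂQ}(W)`. -/
def weightSgrp {β : Q.V → ℕ} (W : QRep Q β) : Set (Q.V → ℤ) :=
  {σ | ∃ α : Q.V → ℕ, (∀ x, β x = 0 → α x = 0) ∧ (PAset (annRel W) α).Nonempty ∧
    ∀ y, β y ≠ 0 → σ y = eulerPair (annRel W) α y}

end ExtHigher

section Tame

variable {Q : Quiv}

/-- Specialization of a representation over `ℂ[x]` at `λ ∈ ℂ`, i.e.
`M ⊗_{ℂ[x]} ℂ[x]/(x−λ)`. -/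
def polyEvalAt {γ : Q.V → ℕ} (M : RepR Q (Polynomial ℂ) γ) (lam : ℂ) : QRep Q γ :=
  fun a => (M a).map (fun p => Polynomial.eval lam p)

/-- The algebra `A = ℂQ/⟨S⟩` is tame: for every dimension `d` there are finitely many
`A`–`ℂ[x]`-bimodules `M₁,…,M_s`, free of finite rank over `ℂ[x]` (i.e. matrix
representations over `ℂ[x]` satisfying the relations), such that all but finitely many
isomorphism classes of `d`-dimensional indecomposable `A`-modules are of the form
`M_i ⊗_{ℂ[x]} ℂ[x]/(x−λ)`. -/
def IsTame (S : Set (FormalRel Q)) : Prop :=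
  ∀ d : ℕ, ∃ (s : ℕ) (γs : Fin s → (Q.V → ℕ)) (M : ∀ i, RepR Q (Polynomial ℂ) (γs i)),
    (∀ i, ∀ r ∈ S, evalLinP (M i) r.2.2 = 0) ∧
    ∃ (t : ℕ) (βs : Fin t → (Q.V → ℕ)) (E : ∀ k, QRep Q (βs k)),
      ∀ (α : Q.V → ℕ) (V : QRep Q α), V ∈ modSet S α → (∑ x, α x) = d → IsIndecRep V →
        (∃ k, RIso (E k) V) ∨ (∃ i lam, RIso (polyEvalAt (M i) lam) V)

end Tame

section Stability

variable {Q : Quiv}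

/-- `U` is a subrepresentation of `V` (a family of subspaces preserved by the structure
maps). -/
def SubRep {α : Q.V → ℕ} (V : QRep Q α) (U : ∀ x : Q.V, Submodule ℂ (Fin (α x) → ℂ)) : Prop :=
  ∀ a : Q.A, (U (Q.t a)).map (Matrix.mulVecLin (V a)) ≤ U (Q.h a)

/-- `V` is `θ`-stable: `V ≠ 0`, `θ · dim V = 0`, and `θ · dim V' < 0` for every proper
nonzero subrepresentation `V'` of `V`. -/
def ThetaStable {α : Q.V → ℕ} (θ : Q.V → ℤ) (V : QRep Q α) : Prop :=
  (∃ x, α x ≠ 0) ∧ (∑ x, θ x * (α x : ℤ)) = 0 ∧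
  ∀ U : ∀ x : Q.V, Submodule ℂ (Fin (α x) → ℂ), SubRep V U →
    (∃ x, U x ≠ ⊥) → (∃ x, U x ≠ ⊤) →
      (∑ x, θ x * (Module.finrank ℂ (U x) : ℤ)) < 0

/-- The morphism with components `f` from `P` is essential onto its image: any
subrepresentation of `P` mapping onto the image of `f` is all of `P`. -/
def IsEssentialTo {γ δ : Q.V → ℕ} (P : QRep Q γ)
    (f : ∀ x : Q.V, Matrix (Fin (δ x)) (Fin (γ x)) ℂ) : Prop :=
  ∀ U : ∀ x : Q.V, Submodule ℂ (Fin (γ x) → ℂ), SubRep P U →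
    (∀ x, (U x).map (Matrix.mulVecLin (f x)) = LinearMap.range (Matrix.mulVecLin (f x))) →
      ∀ x, U x = ⊤

end Stability

section Ideal

variable {Q : Quiv}

/-- The `(x,y)`-component of the two-sided ideal `⟨S⟩` of `ℂQ` generated by the
relations in `S`: the span of the translates `q·r·p` of relations `r ∈ S` by paths. -/
def idealComp (S : Set (FormalRel Q)) (x y : Q.V) : Submodule ℂ (Quiver.Path x y →₀ ℂ) :=
  Submodule.span ℂ {c | ∃ r ∈ S, ∃ (p : Quiver.Path x r.1) (q : Quiver.Path r.2.1 y),
    c = Finsupp.mapDomain (fun s => (p.comp s).comp q) r.2.2}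

/-- `W` is a faithful module over `A = ℂQ/⟨S⟩`: every element of `ℂQ` annihilating `W`
lies in the ideal `⟨S⟩`. -/
def FaithfulOver (S : Set (FormalRel Q)) {β : Q.V → ℕ} (W : QRep Q β) : Prop :=
  ∀ (x y : Q.V) (c : Quiver.Path x y →₀ ℂ), evalLin W c = 0 → c ∈ idealComp S x y

end Ideal
section Precomp

variable {Q : Quiv}

/-- Precomposition with a morphism `f : L → M` of representations, as a linear map
`Hom(M,N) → Hom(L,N)`, `φ ↦ φ ∘ f`. -/
def precompMap {γ₁ γ₀ δ : Q.V → ℕ} (L : QRep Q γ₁) (M : QRep Q γ₀) (N : QRep Q δ)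
    (f : ∀ x : Q.V, Matrix (Fin (γ₀ x)) (Fin (γ₁ x)) ℂ) (hf : f ∈ HomS L M) :
    (HomS M N) →ₗ[ℂ] (HomS L N) where
  toFun φ := ⟨fun x => φ.1 x * f x, by
    intro a
    have h1 : φ.1 (Q.h a) * M a = N a * φ.1 (Q.t a) := φ.2 a
    have h2 : f (Q.h a) * L a = M a * f (Q.t a) := hf a
    calc (φ.1 (Q.h a) * f (Q.h a)) * L a
        = φ.1 (Q.h a) * (f (Q.h a) * L a) := by rw [Matrix.mul_assoc]
      _ = φ.1 (Q.h a) * (M a * f (Q.t a)) := by rw [h2]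
      _ = (φ.1 (Q.h a) * M a) * f (Q.t a) := by rw [Matrix.mul_assoc]
      _ = (N a * φ.1 (Q.t a)) * f (Q.t a) := by rw [h1]
      _ = N a * (φ.1 (Q.t a) * f (Q.t a)) := by rw [Matrix.mul_assoc]⟩
  map_add' φ ψ := by
    apply Subtype.ext
    funext x
    simp [Matrix.add_mul]
  map_smul' c φ := by
    apply Subtype.ext
    funext x
    simp [Matrix.smul_mul]

end Precomp

section BipartiteQsig

variable (Q : Quiv) (β : Q.V → ℕ) (σ : Q.V → ℤ)

/-- The bipartite quiver `Q^σ`: its vertices are the vertices of `Q` where `σ` is positive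
together with those where `σ` is negative, and it has one arrow `a_p : v_i → w_j` for every
oriented path `p` in `Q` from `v_i` to `w_j`. -/
def Qsig : Quiv where
  V := PosV Q σ ⊕ NegV Q σ
  A := Σ (i : PosV Q σ) (j : NegV Q σ), Quiver.Path i.1 j.1
  t := fun a => Sum.inl a.1
  h := fun a => Sum.inr a.2.1
  fV := inferInstance
  dV := inferInstance

/-- The dimension vector `β` restricted to `Q^σ`. -/
def betaSig : (Qsig Q σ).V → ℕ := Sum.elim (fun i => β i.1) (fun j => β j.1)

/-- The weight `σ` restricted to `Q^σ`. -/
def sigSig : (Qsig Q σ).V → ℤ := Sum.elim (fun i => σ i.1) (fun j => σ j.1)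

/-- The morphism `φ : rep(Q,β) → rep(Q^σ,β)` given by `φ(W)(a_p) = W(p)`. -/
def phiSig (W : QRep Q β) : QRep (Qsig Q σ) (betaSig Q β σ) :=
  fun a => evalPath W a.2.2

end BipartiteQsig

open scoped IntermediateField.algebraAdjoinAdjoin in
/-- In characteristic zero, a derivation may be prescribed freely on a transcendence basis. -/
theorem exists_derivation_of_isTranscendenceBasis {k L ι : Type*} [Field k] [Field L] [CharZero k]
    [Algebra k L] {b : ι → L} (hb : IsTranscendenceBasis k b) (v : ι → L) :
    ∃ δ : Derivation k L L, ∀ i, δ (b i) = v i := by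
  let A := Algebra.adjoin k (Set.range b)
  let K := IntermediateField.adjoin k (Set.range b)
  have : Algebra.FormallySmooth A K := .of_isLocalization (nonZeroDivisors _)
  have : Algebra.IsAlgebraic K L := hb.isAlgebraic_field
  have : Algebra.FormallyEtale K L := Algebra.FormallyEtale.of_isSeparable _ L
  have : Algebra.FormallySmooth A L := .comp _ K _
  let φ : MvPolynomial ι k →ₐ[k] TrivSqZeroExt L L :=
    MvPolynomial.aeval fun i => TrivSqZeroExt.inl (b i) + TrivSqZeroExt.inr (v i)
  let ψ : A →ₐ[k] TrivSqZeroExt L L := φ.comp hb.1.aevalEquiv.symm.toAlgHom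
  have hψ : ∀ a : A, (ψ a).fst = a := by
    intro a
    obtain ⟨p, rfl⟩ := hb.1.aevalEquiv.surjective a
    have : (TrivSqZeroExt.fstHom k L L).comp φ = MvPolynomial.aeval b := by
      ext i; simp [φ]
    have h2 := DFunLike.congr_fun this p
    simpa [ψ] using h2
  let : Algebra A (TrivSqZeroExt L L) := ψ.toRingHom.toAlgebra
  let g : TrivSqZeroExt L L →ₐ[A] L :=
    { (TrivSqZeroExt.fstHom k L L).toRingHom with commutes' := fun a => hψ a }
  have hg : Function.Surjective g := fun x => ⟨TrivSqZeroExt.inl x, rfl⟩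
  have hn : IsNilpotent (RingHom.ker (g : TrivSqZeroExt L L →+* L)) := by
    refine ⟨2, ?_⟩
    rw [Submodule.pow_succ, Submodule.pow_one, Ideal.zero_eq_bot, eq_bot_iff, Ideal.mul_le]
    intro r hr s hs
    have hr' : r.fst = 0 := hr
    have hs' : s.fst = 0 := hs
    rw [Ideal.mem_bot]
    ext <;> simp [hr', hs']
  let F := Algebra.FormallySmooth.liftOfSurjective (AlgHom.id A L) g hg hn
  have hF : ∀ x, (F x).fst = x := fun x =>
    Algebra.FormallySmooth.liftOfSurjective_apply (AlgHom.id A L) g hg hn x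
  have hFA : ∀ a : A, F (a : L) = ψ a := fun a => F.commutes a
  refine ⟨Derivation.mk' { toFun := fun x => (F x).snd, map_add' := ?_, map_smul' := ?_ } ?_, ?_⟩
  · intro x y; simp
  · intro c x
    have h1 := hFA (algebraMap k A c)
    rw [ψ.commutes] at h1
    have h2 : F (c • x) = algebraMap k (TrivSqZeroExt L L) c * F x := by
      rw [Algebra.smul_def, map_mul, ← h1]; rfl
    rw [h2, ← Algebra.smul_def]; rfl
  · intro x y
    simp [hF, mul_comm]
  · intro i
    have h1 := hFA ⟨b i, Algebra.subset_adjoin ⟨i, rfl⟩⟩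
    have h2 : hb.1.aevalEquiv (MvPolynomial.X i) = (⟨b i, Algebra.subset_adjoin ⟨i, rfl⟩⟩ : A) :=
      Subtype.ext (by simp)
    change (F (b i)).snd = v i
    rw [show F (b i) = _ from h1, ← h2]
    simp [ψ, φ]

/-- A nonempty open subset of `ℂⁿ` contains a point at which derivations of `ℂ` killing a given
countable set take arbitrary values. -/
theorem exists_generic_point {S : Set ℂ} (hS : S.Countable) {n : ℕ} {O : Set (Fin n → ℂ)}
    (hO : IsOpen O) (hne : O.Nonempty) :
    ∃ c ∈ O, ∀ v : Fin n → ℂ, ∃ δ : Derivation ℤ ℂ ℂ,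
      (∀ s ∈ S, δ s = 0) ∧ ∀ j, δ (c j) = v j := by
  obtain ⟨D, hDc, hDd⟩ := TopologicalSpace.exists_countable_dense ℂ
  let k := Subfield.closure (S ∪ D)
  have hk : Cardinal.mk k ≤ Cardinal.aleph0 := by
    refine (Subfield.cardinalMk_closure_le_max _).trans (max_le ?_ le_rfl)
    exact (Cardinal.le_aleph0_iff_set_countable).2 (hS.union hDc)
  obtain ⟨ι, b, hb⟩ := exists_isTranscendenceBasis' k ℂ
  have hι : Infinite ι := by
    by_contra hfin
    rw [not_infinite_iff_finite] at hfin
    have h1 := IsAlgClosed.cardinal_le_max_transcendence_basis b hb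
    have h2 : max (max (Cardinal.mk k) (Cardinal.mk ι)) Cardinal.aleph0 ≤ Cardinal.aleph0 :=
      max_le (max_le hk (Cardinal.mk_le_aleph0)) le_rfl
    simp only [Cardinal.lift_id, Cardinal.mk_complex] at h1
    exact absurd (h1.trans h2) (not_le.2 Cardinal.aleph0_lt_continuum)
  obtain ⟨c₀, hc₀⟩ := hne
  obtain ⟨ε, hε, hball⟩ := Metric.isOpen_iff.1 hO c₀ hc₀
  let e : Fin n → ι := fun j => Infinite.natEmbedding ι j
  have he : Function.Injective e := fun i j h => Fin.ext ((Infinite.natEmbedding ι).injective h)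
  have key : ∀ j, ∃ r ∈ D, ∃ m : ℕ, ‖r + (1 / ((m : ℂ) + 1)) * b (e j) - c₀ j‖ < ε := by
    intro j
    obtain ⟨r, hr, hrD⟩ := hDd.exists_dist_lt (c₀ j) (half_pos hε)
    obtain ⟨m, hm⟩ := exists_nat_gt (‖b (e j)‖ / (ε / 2))
    refine ⟨r, hr, m, ?_⟩
    have h1 : ‖(1 / ((m : ℂ) + 1)) * b (e j)‖ < ε / 2 := by
      have hm1 : ‖(m : ℂ) + 1‖ = m + 1 := by
        have := Complex.norm_natCast (m + 1)
        push_cast at this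
        exact this
      rw [norm_mul, norm_div, norm_one, hm1, one_div, inv_mul_lt_iff₀ (by positivity)]
      rw [div_lt_iff₀ (half_pos hε)] at hm
      nlinarith
    rw [dist_eq_norm'] at hrD
    calc _ = ‖(r - c₀ j) + (1 / ((m : ℂ) + 1)) * b (e j)‖ := by congr 1; ring
      _ ≤ _ := norm_add_le _ _
      _ < ε / 2 + ε / 2 := add_lt_add hrD h1
      _ = ε := add_halves ε
  choose r hrD m hm using key
  refine ⟨fun j => r j + (1 / ((m j : ℂ) + 1)) * b (e j), hball ?_, fun v => ?_⟩
  · rw [Metric.mem_ball, dist_pi_lt_iff hε]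
    intro j
    rw [dist_eq_norm]
    exact hm j
  · obtain ⟨δ, hδ⟩ := exists_derivation_of_isTranscendenceBasis hb
      (Function.extend e (fun j => ((m j : ℂ) + 1) * v j) 0)
    have hδk : ∀ x ∈ S ∪ D, δ x = 0 := fun x hx =>
      δ.map_algebraMap (⟨x, Subfield.subset_closure hx⟩ : k)
    refine ⟨δ.restrictScalars ℤ, fun s hs => hδk s (Or.inl hs), fun j => ?_⟩
    have h1 : (1 / ((m j : ℂ) + 1)) * b (e j) = (1 / ((m j : k) + 1)) • b (e j) := by
      rw [Algebra.smul_def]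
      simp
    change δ (r j + (1 / ((m j : ℂ) + 1)) * b (e j)) = v j
    rw [map_add, hδk _ (Or.inr (hrD j)), h1, δ.map_smul, hδ, he.extend_apply, zero_add,
      Algebra.smul_def]
    have : (m j : ℂ) + 1 ≠ 0 := Nat.cast_add_one_ne_zero _
    simp
    field_simp

theorem castM_rfl {R : Type} {m n : ℕ} (M : Matrix (Fin m) (Fin n) R) :
    castM rfl rfl M = M := rfl

section Morphisms

variable {Q : Quiv} {α β γ : Q.V → ℕ}

theorem evalPath_naturality {V : QRep Q α} {W : QRep Q γ}
    {φ : ∀ x, Matrix (Fin (γ x)) (Fin (α x)) ℂ} (hφ : φ ∈ HomS V W) {x y : Q.V}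
    (p : Quiver.Path x y) : φ y * evalPath V p = evalPath W p * φ x := by
  induction p with
  | nil => simp [evalPath]
  | cons p e ih =>
    obtain ⟨a, rfl, rfl⟩ := e
    have h := hφ a
    simp only [evalPath, castM_rfl]
    rw [← Matrix.mul_assoc, h, Matrix.mul_assoc, ih, Matrix.mul_assoc]

theorem evalLin_naturality {V : QRep Q α} {W : QRep Q γ}
    {φ : ∀ x, Matrix (Fin (γ x)) (Fin (α x)) ℂ} (hφ : φ ∈ HomS V W) {x y : Q.V}
    (c : Quiver.Path x y →₀ ℂ) : φ y * evalLin V c = evalLin W c * φ x := by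
  simp only [evalLin, Finsupp.sum, Matrix.mul_sum, Matrix.sum_mul, Matrix.mul_smul,
    Matrix.smul_mul, evalPath_naturality hφ]

theorem mem_modSet_of_rightInverse {S : Set (FormalRel Q)} {V : QRep Q α} {W : QRep Q γ}
    {φ : ∀ x, Matrix (Fin (γ x)) (Fin (α x)) ℂ} (hφ : φ ∈ HomS V W)
    {s : ∀ x, Matrix (Fin (α x)) (Fin (γ x)) ℂ} (hs : ∀ x, φ x * s x = 1)
    (hV : V ∈ modSet S α) : W ∈ modSet S γ := by
  intro r hr
  have h := evalLin_naturality hφ r.2.2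
  rw [hV r hr, Matrix.mul_zero] at h
  rw [← Matrix.mul_one (evalLin W r.2.2), ← hs, ← Matrix.mul_assoc, ← h, Matrix.zero_mul]

theorem comp_mem_HomS {U : QRep Q α} {V : QRep Q β} {W : QRep Q γ}
    {φ : ∀ x, Matrix (Fin (γ x)) (Fin (β x)) ℂ} {ψ : ∀ x, Matrix (Fin (β x)) (Fin (α x)) ℂ}
    (hφ : φ ∈ HomS V W) (hψ : ψ ∈ HomS U V) : (fun x => φ x * ψ x) ∈ HomS U W := by
  intro a
  have h1 := hφ a
  have h2 := hψ a
  rw [Matrix.mul_assoc, h2, ← Matrix.mul_assoc, h1, Matrix.mul_assoc]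

theorem surjective_mulVecLin_of_mul_eq_one {m n : ℕ} {A : Matrix (Fin m) (Fin n) ℂ}
    {B : Matrix (Fin n) (Fin m) ℂ} (h : A * B = 1) : Function.Surjective A.mulVecLin :=
  fun v => ⟨B *ᵥ v, by simp [h]⟩

theorem injective_mulVecLin_of_mul_eq_one {m n : ℕ} {A : Matrix (Fin m) (Fin n) ℂ}
    {B : Matrix (Fin n) (Fin m) ℂ} (h : B * A = 1) : Function.Injective A.mulVecLin :=
  Function.LeftInverse.injective (g := B.mulVecLin) fun v => by simp [h]

end Morphisms

/-- `0 → P₁ → P₀ → X → 0` is a short exact sequence of representations, with maps `f` and `p`,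
which is split vertexwise by the retractions `r` and the sections `s`. -/
structure SplitSeq {Q : Quiv} {γ₁ γ₀ α : Q.V → ℕ} (P₁ : QRep Q γ₁) (P₀ : QRep Q γ₀) (X : QRep Q α)
    (f : ∀ x, Matrix (Fin (γ₀ x)) (Fin (γ₁ x)) ℂ) (p : ∀ x, Matrix (Fin (α x)) (Fin (γ₀ x)) ℂ)
    (r : ∀ x, Matrix (Fin (γ₁ x)) (Fin (γ₀ x)) ℂ) (s : ∀ x, Matrix (Fin (γ₀ x)) (Fin (α x)) ℂ) :
    Prop where
  f_mem : f ∈ HomS P₁ P₀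
  p_mem : p ∈ HomS P₀ X
  p_mul_s : ∀ x, p x * s x = 1
  r_mul_f : ∀ x, r x * f x = 1
  add_eq_one : ∀ x, f x * r x + s x * p x = 1

namespace SplitSeq

variable {Q : Quiv} {γ₁ γ₀ α α' : Q.V → ℕ} {P₁ : QRep Q γ₁} {P₀ : QRep Q γ₀} {X : QRep Q α}
  {f : ∀ x, Matrix (Fin (γ₀ x)) (Fin (γ₁ x)) ℂ} {p : ∀ x, Matrix (Fin (α x)) (Fin (γ₀ x)) ℂ}
  {r : ∀ x, Matrix (Fin (γ₁ x)) (Fin (γ₀ x)) ℂ} {s : ∀ x, Matrix (Fin (γ₀ x)) (Fin (α x)) ℂ}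
  {R : Set (FormalRel Q)}

theorem p_mul_f (h : SplitSeq P₁ P₀ X f p r s) (x : Q.V) : p x * f x = 0 := by
  have h1 : p x * (f x * r x + s x * p x) * f x = p x * f x + p x * f x := by
    rw [Matrix.mul_add, Matrix.add_mul, ← Matrix.mul_assoc, ← Matrix.mul_assoc, h.p_mul_s,
      Matrix.one_mul, Matrix.mul_assoc, h.r_mul_f, Matrix.mul_one]
  rw [h.add_eq_one, Matrix.mul_one] at h1
  simpa using h1

theorem r_mul_s (h : SplitSeq P₁ P₀ X f p r s) (x : Q.V) : r x * s x = 0 := by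
  have h1 : r x * (f x * r x + s x * p x) * s x = r x * s x + r x * s x := by
    rw [Matrix.mul_add, Matrix.add_mul, ← Matrix.mul_assoc, ← Matrix.mul_assoc, h.r_mul_f,
      Matrix.one_mul, Matrix.mul_assoc, h.p_mul_s, Matrix.mul_one]
  rw [h.add_eq_one, Matrix.mul_one] at h1
  simpa using h1

theorem eq_mul_of_mul_p (h : SplitSeq P₁ P₀ X f p r s) (x : Q.V) {m : ℕ}
    {M : Matrix (Fin (γ₀ x)) (Fin m) ℂ} (hM : p x * M = 0) : M = f x * (r x * M) := by
  conv_lhs => rw [← Matrix.one_mul M, ← h.add_eq_one, Matrix.add_mul, Matrix.mul_assoc (s x), hM,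
    Matrix.mul_zero, add_zero, Matrix.mul_assoc]

theorem eq_mul_of_mul_f (h : SplitSeq P₁ P₀ X f p r s) (x : Q.V) {m : ℕ}
    {M : Matrix (Fin m) (Fin (γ₀ x)) ℂ} (hM : M * f x = 0) : M = M * s x * p x := by
  conv_lhs => rw [← Matrix.mul_one M, ← h.add_eq_one, Matrix.mul_add, ← Matrix.mul_assoc, hM,
    Matrix.zero_mul, zero_add, ← Matrix.mul_assoc]

/-- Morphisms into `P₀` killed by `p` factor through `f`. -/
theorem exists_factor (h : SplitSeq P₁ P₀ X f p r s) {γ : Q.V → ℕ} {P : QRep Q γ}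
    {φ : ∀ x, Matrix (Fin (γ₀ x)) (Fin (γ x)) ℂ} (hφ : φ ∈ HomS P P₀)
    (h0 : ∀ x, p x * φ x = 0) : ∃ b ∈ HomS P P₁, ∀ x, φ x = f x * b x := by
  have hfac := fun x => h.eq_mul_of_mul_p x (h0 x)
  refine ⟨fun x => r x * φ x, fun a => ?_, hfac⟩
  have h1 := hφ a
  have h2 := h.f_mem a
  calc r (Q.h a) * φ (Q.h a) * P a = r (Q.h a) * (P₀ a * φ (Q.t a)) := by rw [Matrix.mul_assoc, h1]
    _ = r (Q.h a) * (P₀ a * (f (Q.t a) * (r (Q.t a) * φ (Q.t a)))) := by rw [← hfac]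
    _ = r (Q.h a) * (f (Q.h a) * P₁ a) * (r (Q.t a) * φ (Q.t a)) := by
      rw [h2]; simp only [Matrix.mul_assoc]
    _ = P₁ a * (r (Q.t a) * φ (Q.t a)) := by
      rw [← Matrix.mul_assoc (r _), h.r_mul_f, Matrix.one_mul]

theorem morSurj (h : SplitSeq P₁ P₀ X f p r s) : MorSurj p :=
  fun x => surjective_mulVecLin_of_mul_eq_one (h.p_mul_s x)

theorem mem_PAset (h : SplitSeq P₁ P₀ X f p r s) (h₀ : P₀ ∈ modSet R γ₀) (h₁ : P₁ ∈ modSet R γ₁)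
    (hp₀ : IsProjRep R P₀) (hp₁ : IsProjRep R P₁) : X ∈ PAset R α := by
  refine ⟨mem_modSet_of_rightInverse h.p_mem h.p_mul_s h₀, γ₀, γ₁, P₀, P₁, h₀, h₁, hp₀, hp₁, f,
    h.f_mem, p, h.p_mem, fun x => injective_mulVecLin_of_mul_eq_one (h.r_mul_f x), h.morSurj,
    fun x => le_antisymm ?_ ?_⟩
  · rintro _ ⟨v, rfl⟩
    simp [h.p_mul_f]
  · intro v hv
    have hv' : p x *ᵥ v = 0 := by simpa using hv
    refine ⟨r x *ᵥ v, ?_⟩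
    have := congrArg (· *ᵥ v) (h.add_eq_one x)
    simpa [Matrix.add_mulVec, ← Matrix.mulVec_mulVec, hv'] using this

theorem of_exact {i : ∀ x, Matrix (Fin (γ₀ x)) (Fin (γ₁ x)) ℂ}
    {q : ∀ x, Matrix (Fin (α x)) (Fin (γ₀ x)) ℂ} (hi : i ∈ HomS P₁ P₀) (hq : q ∈ HomS P₀ X)
    (hinj : MorInj i) (hsurj : MorSurj q)
    (hex : ∀ x, LinearMap.range (Matrix.mulVecLin (i x)) = LinearMap.ker (Matrix.mulVecLin (q x))) :
    ∃ r s, SplitSeq P₁ P₀ X i q r s := by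
  have hs : ∀ x, ∃ s : Matrix (Fin (γ₀ x)) (Fin (α x)) ℂ, q x * s = 1 := fun x =>
    Matrix.mulVec_surjective_iff_exists_right_inverse.1 (hsurj x)
  choose s hs using hs
  have hr : ∀ x, ∃ r : Matrix (Fin (γ₁ x)) (Fin (γ₀ x)) ℂ, i x * r = 1 - s x * q x := by
    intro x
    have hcol : ∀ j, ∃ v, (i x).mulVecLin v = (1 - s x * q x) *ᵥ Pi.single j 1 := by
      intro j
      rw [← LinearMap.mem_range, hex x]
      simp only [LinearMap.mem_ker, Matrix.mulVecLin_apply, Matrix.mulVec_mulVec]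
      rw [Matrix.mul_sub, ← Matrix.mul_assoc, hs, Matrix.one_mul, Matrix.mul_one, sub_self,
        Matrix.zero_mulVec]
    choose v hv using hcol
    refine ⟨Matrix.of fun k j => v j k, ?_⟩
    ext k j
    have := congrFun (hv j) k
    rw [Matrix.mulVec_single_one] at this
    simpa [Matrix.mul_apply, Matrix.mulVec, dotProduct] using this
  choose r hr using hr
  refine ⟨r, s, hi, hq, hs, fun x => ?_, fun x => by rw [hr]; simp⟩
  have h0 : q x * i x = 0 := by
    ext k j
    have h1 : (i x).mulVecLin (Pi.single j 1) ∈ LinearMap.ker (q x).mulVecLin := by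
      rw [← hex x]; exact ⟨_, rfl⟩
    simp only [LinearMap.mem_ker, Matrix.mulVecLin_apply, Matrix.mulVec_single_one] at h1
    exact congrFun h1 k
  have h1 : i x * (r x * i x) = i x := by
    rw [← Matrix.mul_assoc, hr, Matrix.sub_mul, Matrix.mul_assoc, h0]
    simp
  have h2 : ∀ v, (r x * i x) *ᵥ v = v := by
    intro v
    apply hinj x
    simp [h1]
  ext k j
  have := congrFun (h2 (Pi.single j 1)) k
  rw [Matrix.mulVec_single_one] at this
  simpa [Matrix.one_apply, Pi.single_apply] using this

/-- The cokernel of `g`, realised on the complement of its image spanned by `s`. -/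
def cokerRep (P₀ : QRep Q γ₀) (p : ∀ x, Matrix (Fin (α x)) (Fin (γ₀ x)) ℂ)
    (r : ∀ x, Matrix (Fin (γ₁ x)) (Fin (γ₀ x)) ℂ) (s : ∀ x, Matrix (Fin (γ₀ x)) (Fin (α x)) ℂ)
    (g : ∀ x, Matrix (Fin (γ₀ x)) (Fin (γ₁ x)) ℂ) : QRep Q α :=
  fun a => p (Q.h a) * (g (Q.h a) * r (Q.h a) + s (Q.h a) * p (Q.h a))⁻¹ * P₀ a * s (Q.t a)

theorem cokerRep_self (h : SplitSeq P₁ P₀ X f p r s) : cokerRep P₀ p r s f = X := by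
  funext a
  have h1 := h.p_mem a
  simp only [cokerRep]
  rw [h.add_eq_one, inv_one, Matrix.mul_one, h1, Matrix.mul_assoc, h.p_mul_s, Matrix.mul_one]

theorem deform (h : SplitSeq P₁ P₀ X f p r s) {g : ∀ x, Matrix (Fin (γ₀ x)) (Fin (γ₁ x)) ℂ}
    (hg : g ∈ HomS P₁ P₀) (hdet : ∀ x, (g x * r x + s x * p x).det ≠ 0) :
    SplitSeq P₁ P₀ (cokerRep P₀ p r s g) g (fun x => p x * (g x * r x + s x * p x)⁻¹)
      (fun x => r x * (g x * r x + s x * p x)⁻¹) s := by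
  have hu : ∀ x, IsUnit (g x * r x + s x * p x).det := fun x => (hdet x).isUnit
  have hGf : ∀ x, (g x * r x + s x * p x)⁻¹ * g x = f x := fun x => by
    have : (g x * r x + s x * p x) * f x = g x := by
      rw [Matrix.add_mul, Matrix.mul_assoc, Matrix.mul_assoc, h.r_mul_f, h.p_mul_f]
      simp
    calc (g x * r x + s x * p x)⁻¹ * g x
        = (g x * r x + s x * p x)⁻¹ * ((g x * r x + s x * p x) * f x) := by rw [this]
      _ = f x := by
        rw [← Matrix.mul_assoc, Matrix.nonsing_inv_mul _ (hu x), Matrix.one_mul]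
  have hGs : ∀ x, (g x * r x + s x * p x)⁻¹ * s x = s x := fun x => by
    have : (g x * r x + s x * p x) * s x = s x := by
      rw [Matrix.add_mul, Matrix.mul_assoc, Matrix.mul_assoc, h.r_mul_s, h.p_mul_s]
      simp
    calc (g x * r x + s x * p x)⁻¹ * s x
        = (g x * r x + s x * p x)⁻¹ * ((g x * r x + s x * p x) * s x) := by rw [this]
      _ = s x := by
        rw [← Matrix.mul_assoc, Matrix.nonsing_inv_mul _ (hu x), Matrix.one_mul]
  have hone : ∀ x, g x * (r x * (g x * r x + s x * p x)⁻¹) +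
      s x * (p x * (g x * r x + s x * p x)⁻¹) = 1 := fun x => by
    rw [← Matrix.mul_assoc, ← Matrix.mul_assoc, ← Matrix.add_mul, Matrix.mul_nonsing_inv _ (hu x)]
  refine ⟨hg, fun a => ?_, fun x => ?_, fun x => ?_, hone⟩
  · have h1 := hg a
    have h2 := hone (Q.t a)
    set q := p (Q.h a) * (g (Q.h a) * r (Q.h a) + s (Q.h a) * p (Q.h a))⁻¹ with hq
    have hqg : q * g (Q.h a) = 0 := by rw [hq, Matrix.mul_assoc, hGf, h.p_mul_f]
    have h3 : q * P₀ a * g (Q.t a) = 0 := by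
      rw [Matrix.mul_assoc, ← h1, ← Matrix.mul_assoc, hqg, Matrix.zero_mul]
    simp only [cokerRep, ← hq]
    conv_lhs => rw [← Matrix.mul_one (q * P₀ a), ← h2, Matrix.mul_add, ← Matrix.mul_assoc, h3,
      Matrix.zero_mul, zero_add, ← Matrix.mul_assoc]
  · simp only [Matrix.mul_assoc]
    rw [hGs, h.p_mul_s]
  · simp only [Matrix.mul_assoc]
    rw [hGf, h.r_mul_f]

end SplitSeq

section Extension

variable {Q : Quiv} {α γ : Q.V → ℕ}

/-- The extension of `V` by `W` defined by the cochain `φ`. -/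
def extRep (V : QRep Q α) (W : QRep Q γ) (φ : C1sp (Q := Q) α γ) :
    QRep Q (fun x => γ x + α x) :=
  fun a => Matrix.reindex finSumFinEquiv finSumFinEquiv (Matrix.fromBlocks (W a) (φ a) 0 (V a))

theorem evalPath_extRep (V : QRep Q α) (W : QRep Q γ) (φ : C1sp (Q := Q) α γ) {x y : Q.V}
    (p : Quiver.Path x y) : evalPath (extRep V W φ) p =
      Matrix.reindex finSumFinEquiv finSumFinEquiv
        (Matrix.fromBlocks (evalPath W p) (der V W φ p) 0 (evalPath V p)) := by
  induction p with
  | nil => simp [evalPath, der]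
  | cons p e ih =>
    obtain ⟨a, rfl, rfl⟩ := e
    simp only [evalPath, der, castM_rfl, ih, extRep, Matrix.reindex_apply,
      Matrix.submatrix_mul_equiv, Matrix.fromBlocks_multiply]
    simp [add_comm]

theorem extRep_mem_modSet {R : Set (FormalRel Q)} {V : QRep Q α} {W : QRep Q γ}
    {φ : C1sp (Q := Q) α γ} (hV : V ∈ modSet R α) (hW : W ∈ modSet R γ) (hφ : φ ∈ Z1 R V W) :
    extRep V W φ ∈ modSet R (fun x => γ x + α x) := by
  intro ρ hρ
  have h : evalLin (extRep V W φ) ρ.2.2 = Matrix.reindex finSumFinEquiv finSumFinEquiv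
      (Matrix.fromBlocks (evalLin W ρ.2.2) (derRel V W φ ρ.2.2) 0 (evalLin V ρ.2.2)) := by
    ext i j
    simp only [evalLin, derRel, Finsupp.sum, evalPath_extRep]
    rcases finSumFinEquiv.surjective i with ⟨i | i, rfl⟩ <;>
      rcases finSumFinEquiv.surjective j with ⟨j | j, rfl⟩ <;>
      simp [Matrix.sum_apply]
  rw [h, hV ρ hρ, hW ρ hρ, hφ ρ hρ]
  simp

end Extension

namespace SplitSeq

variable {Q : Quiv} {γ₁ γ₀ α α' : Q.V → ℕ} {P₁ : QRep Q γ₁} {P₀ : QRep Q γ₀} {X : QRep Q α}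
  {Y : QRep Q α'}
  {f : ∀ x, Matrix (Fin (γ₀ x)) (Fin (γ₁ x)) ℂ} {p : ∀ x, Matrix (Fin (α x)) (Fin (γ₀ x)) ℂ}
  {r : ∀ x, Matrix (Fin (γ₁ x)) (Fin (γ₀ x)) ℂ} {s : ∀ x, Matrix (Fin (γ₀ x)) (Fin (α x)) ℂ}
  {g : ∀ x, Matrix (Fin (γ₀ x)) (Fin (γ₁ x)) ℂ} {q : ∀ x, Matrix (Fin (α' x)) (Fin (γ₀ x)) ℂ}
  {r' : ∀ x, Matrix (Fin (γ₁ x)) (Fin (γ₀ x)) ℂ} {s' : ∀ x, Matrix (Fin (γ₀ x)) (Fin (α' x)) ℂ}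
  {R : Set (FormalRel Q)}

theorem Z1_le_B1 (hX : SplitSeq P₁ P₀ X f p r s) (hY : SplitSeq P₁ P₀ Y g q r' s')
    (h₀ : P₀ ∈ modSet R γ₀) (hp₀ : IsProjRep R P₀) (hp₁ : IsProjRep R P₁)
    (hsurj : ∀ η ∈ HomS P₁ P₀, ∃ a ∈ HomS P₀ P₀, ∃ b ∈ HomS P₁ P₁,
      ∀ x, η x = a x * f x + g x * b x) : Z1 R X Y ≤ B1 X Y := by
  intro ζ hζ
  have hXm := mem_modSet_of_rightInverse hX.p_mem hX.p_mul_s h₀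
  have hYm := mem_modSet_of_rightInverse hY.p_mem hY.p_mul_s h₀
  let π : ∀ x, Matrix (Fin (α x)) (Fin (α' x + α x)) ℂ := fun x =>
    (Matrix.fromCols 0 1).submatrix id finSumFinEquiv.symm
  have hπ : π ∈ HomS (extRep X Y ζ) X := by
    intro a
    simp only [π, extRep, Matrix.reindex_apply]
    rw [Matrix.submatrix_mul_equiv, Matrix.fromCols_mul_fromBlocks]
    ext i j
    rcases finSumFinEquiv.surjective j with ⟨j | j, rfl⟩ <;>
      simp [Matrix.mul_apply, Matrix.one_apply]
  have hπs : MorSurj π := by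
    intro x
    refine surjective_mulVecLin_of_mul_eq_one
      (B := (Matrix.fromRows 0 1).submatrix finSumFinEquiv.symm id) ?_
    simp [π, Matrix.submatrix_mul_equiv, Matrix.fromCols_mul_fromRows]
  obtain ⟨l, hl, hπl⟩ := hp₀ _ _ _ _ (extRep_mem_modSet hXm hYm hζ) hXm π hπ hπs p hX.p_mem
  let u : ∀ x, Matrix (Fin (α' x)) (Fin (γ₀ x)) ℂ := fun x => (l x).submatrix (Fin.castAdd _) id
  have hlow : ∀ x i j, l x (Fin.natAdd _ i) j = p x i j := by
    intro x i j
    rw [← hπl]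
    simp only [π, Matrix.mul_apply]
    rw [← finSumFinEquiv.sum_comp]
    simp [Matrix.one_apply]
  have hu : ∀ a, u (Q.h a) * P₀ a = Y a * u (Q.t a) + ζ a * p (Q.t a) := by
    intro a
    ext i j
    have h1 := congrFun (congrFun (hl a) (Fin.castAdd _ i)) j
    simp only [Matrix.mul_apply, extRep] at h1
    rw [← finSumFinEquiv.sum_comp] at h1
    simp only [Fintype.sum_sum_type, finSumFinEquiv_apply_left, finSumFinEquiv_apply_right,
      hlow, Matrix.reindex_apply, Matrix.submatrix_apply, finSumFinEquiv_symm_apply_castAdd,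
      finSumFinEquiv_symm_apply_natAdd, Matrix.fromBlocks_apply₁₁, Matrix.fromBlocks_apply₁₂] at h1
    simpa [Matrix.mul_apply, u] using h1
  have huf : (fun x => u x * f x) ∈ HomS P₁ Y := by
    intro a
    have h1 := hX.f_mem a
    rw [Matrix.mul_assoc, h1, ← Matrix.mul_assoc, hu, Matrix.add_mul, Matrix.mul_assoc (ζ a),
      hX.p_mul_f, Matrix.mul_zero, add_zero, Matrix.mul_assoc]
  obtain ⟨η, hη, hqη⟩ := hp₁ _ _ _ _ h₀ hYm q hY.p_mem hY.morSurj _ huf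
  obtain ⟨a, ha, b, -, hab⟩ := hsurj η hη
  let u' : ∀ x, Matrix (Fin (α' x)) (Fin (γ₀ x)) ℂ := fun x => u x - q x * a x
  have hu'f : ∀ x, u' x * f x = 0 := by
    intro x
    rw [Matrix.sub_mul, ← hqη, hab, Matrix.mul_add, ← Matrix.mul_assoc, ← Matrix.mul_assoc,
      hY.p_mul_f, Matrix.zero_mul, add_zero, sub_self]
  have hfac := fun x => hX.eq_mul_of_mul_f x (hu'f x)
  have hu' : ∀ a, u' (Q.h a) * P₀ a = Y a * u' (Q.t a) + ζ a * p (Q.t a) := by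
    intro c
    have h1 := comp_mem_HomS hY.p_mem ha c
    simp only at h1
    simp only [u', Matrix.sub_mul, Matrix.mul_sub, hu, h1]
    abel
  refine ⟨fun x => u' x * s x, ?_⟩
  funext c
  have h1 : ζ c = (u' (Q.h c) * P₀ c - Y c * u' (Q.t c)) * s (Q.t c) := by
    rw [hu', add_sub_cancel_left, Matrix.mul_assoc, hX.p_mul_s, Matrix.mul_one]
  have h2 := hX.p_mem c
  have h3 : u' (Q.h c) * P₀ c * s (Q.t c) = u' (Q.h c) * s (Q.h c) * X c :=
    calc u' (Q.h c) * P₀ c * s (Q.t c)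
        = u' (Q.h c) * s (Q.h c) * p (Q.h c) * P₀ c * s (Q.t c) := by rw [← hfac]
      _ = u' (Q.h c) * s (Q.h c) * (p (Q.h c) * P₀ c) * s (Q.t c) := by
        rw [Matrix.mul_assoc (u' (Q.h c) * s (Q.h c))]
      _ = u' (Q.h c) * s (Q.h c) * X c := by
        rw [h2, Matrix.mul_assoc (u' (Q.h c) * s (Q.h c)), Matrix.mul_assoc (X c), hX.p_mul_s,
          Matrix.mul_one]
  rw [h1, Matrix.sub_mul, h3, Matrix.mul_assoc (Y c)]
  rfl

theorem dimExt1_eq_zero_of_le {V : QRep Q α} {W : QRep Q α'} (h : Z1 R V W ≤ B1 V W) :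
    dimExt1 R V W = 0 := by
  rw [dimExt1, inf_eq_right.2 h, Nat.sub_self]

end SplitSeq

section DerivationMap

theorem Matrix.map_derivation_mul (δ : Derivation ℤ ℂ ℂ) {l m n : Type*} [Fintype m]
    (A : Matrix l m ℂ) (B : Matrix m n ℂ) :
    (A * B).map δ = A.map δ * B + A * B.map δ := by
  ext i j
  simp only [Matrix.map_apply, Matrix.mul_apply, map_sum, Derivation.leibniz, Matrix.add_apply,
    Finset.sum_add_distrib, smul_eq_mul]
  rw [add_comm]
  congr 1
  exact Finset.sum_congr rfl fun _ _ => mul_comm _ _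

theorem Matrix.map_derivation_zero (δ : Derivation ℤ ℂ ℂ) {l m : Type*} :
    (0 : Matrix l m ℂ).map δ = 0 := by
  ext; simp

variable {Q : Quiv} {γ₁ γ₀ α γ : Q.V → ℕ} {P₁ : QRep Q γ₁} {P₀ : QRep Q γ₀} {X : QRep Q α}
  {f : ∀ x, Matrix (Fin (γ₀ x)) (Fin (γ₁ x)) ℂ} {p : ∀ x, Matrix (Fin (α x)) (Fin (γ₀ x)) ℂ}
  {r : ∀ x, Matrix (Fin (γ₁ x)) (Fin (γ₀ x)) ℂ} {s : ∀ x, Matrix (Fin (γ₀ x)) (Fin (α x)) ℂ}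
  {R : Set (FormalRel Q)}

/-- If a representation is isomorphic to one with entries killed by a derivation, then applying
the derivation to its entries gives a coboundary. -/
theorem RIso.exists_map_derivation_eq {M : QRep Q γ} (h : RIso M X) (δ : Derivation ℤ ℂ ℂ)
    (hM : ∀ a, (M a).map δ = 0) :
    ∃ w : ∀ x, Matrix (Fin (α x)) (Fin (α x)) ℂ,
      ∀ a, (X a).map δ = w (Q.h a) * X a - X a * w (Q.t a) := by
  obtain ⟨u, hu⟩ := h
  let U : ∀ x, Matrix (Fin (α x)) (Fin (γ x)) ℂ := fun x => LinearMap.toMatrix' (u x).toLinearMap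
  let V : ∀ x, Matrix (Fin (γ x)) (Fin (α x)) ℂ := fun x =>
    LinearMap.toMatrix' (u x).symm.toLinearMap
  have hUV : ∀ x, U x * V x = 1 := fun x => by
    simp only [U, V]
    rw [← LinearMap.toMatrix'_comp]
    simp
  have hVU : ∀ x, V x * U x = 1 := fun x => by
    simp only [U, V]
    rw [← LinearMap.toMatrix'_comp]
    simp
  have hUM : ∀ a, U (Q.h a) * M a = X a * U (Q.t a) := fun a => by
    have := congrArg LinearMap.toMatrix' (hu a)
    simpa [LinearMap.toMatrix'_comp, U, ← Matrix.toLin'_apply', LinearMap.toMatrix'_toLin']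
      using this
  refine ⟨fun x => (U x).map δ * V x, fun a => ?_⟩
  have h1 := congrArg (fun A => A.map δ) (hUM a)
  simp only [Matrix.map_derivation_mul, hM, Matrix.mul_zero, add_zero] at h1
  have h2 : M a = V (Q.h a) * (X a * U (Q.t a)) := by
    rw [← hUM, ← Matrix.mul_assoc, hVU, Matrix.one_mul]
  have h3 := congrArg (fun A => A * V (Q.t a)) h1
  simp only [Matrix.add_mul, Matrix.mul_assoc, hUV, Matrix.mul_one] at h3
  rw [eq_sub_iff_add_eq, ← h3, h2]
  simp only [Matrix.mul_assoc, hUV, Matrix.mul_one]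

theorem SplitSeq.exists_map_derivation_eq (h : SplitSeq P₁ P₀ X f p r s)
    (h₀ : P₀ ∈ modSet R γ₀) (hp₀ : IsProjRep R P₀) (δ : Derivation ℤ ℂ ℂ)
    {M : QRep Q γ} (hMX : RIso M X) (hM : ∀ a, (M a).map δ = 0) (hP₀ : ∀ a, (P₀ a).map δ = 0)
    (hf : (fun x => (f x).map δ) ∈ HomS P₁ P₀) :
    ∃ a ∈ HomS P₀ P₀, ∃ b ∈ HomS P₁ P₁, ∀ x, (f x).map δ = a x * f x + f x * b x := by
  obtain ⟨w, hw⟩ := hMX.exists_map_derivation_eq δ hM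
  have hψ : (fun x => (p x).map δ - w x * p x) ∈ HomS P₀ X := by
    intro a
    have hp := h.p_mem a
    have h1 := congrArg (fun A => A.map δ) hp
    simp only [Matrix.map_derivation_mul, hP₀, Matrix.mul_zero, add_zero, hw] at h1
    simp only [Matrix.sub_mul, Matrix.mul_sub, h1]
    rw [Matrix.mul_assoc (w (Q.h a)) (p (Q.h a)) (P₀ a), hp]
    simp only [Matrix.mul_assoc]
    abel
  have hXm := mem_modSet_of_rightInverse h.p_mem h.p_mul_s h₀
  obtain ⟨a, ha, hpa⟩ := hp₀ _ _ _ _ h₀ hXm p h.p_mem h.morSurj _ hψ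
  have haf := comp_mem_HomS ha h.f_mem
  have hpf : ∀ x, p x * ((f x).map δ + a x * f x) = 0 := by
    intro x
    have h1 := congrArg (fun A => A.map δ) (h.p_mul_f x)
    simp only [Matrix.map_derivation_mul, Matrix.map_derivation_zero] at h1
    rw [Matrix.mul_add, ← Matrix.mul_assoc, hpa, Matrix.sub_mul, Matrix.mul_assoc (w x), h.p_mul_f,
      Matrix.mul_zero, sub_zero, add_comm, h1]
  obtain ⟨b, hb, hfb⟩ := h.exists_factor ((HomS P₁ P₀).add_mem hf haf) hpf
  refine ⟨-a, (HomS P₀ P₀).neg_mem ha, b, hb, fun x => ?_⟩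
  rw [← hfb]
  simp

end DerivationMap

section LinearAlgebra

open Filter Topology

theorem LinearMap.eventually_surjective_add_smul {E H : Type*} [AddCommGroup E] [Module ℂ E]
    [AddCommGroup H] [Module ℂ H] [FiniteDimensional ℂ H] {L M : E →ₗ[ℂ] H} {v : E}
    (hL : L v = 0) (hM : LinearMap.range L ⊔ ℂ ∙ M v = ⊤) :
    ∀ᶠ t in 𝓝[≠] (0 : ℂ), Function.Surjective (L + t • M : E →ₗ[ℂ] H) := by
  obtain ⟨σ, hσ⟩ := (L.coprod (LinearMap.toSpanSingleton ℂ H (M v))).exists_rightInverse_of_surjective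
    (by rw [LinearMap.range_coprod, LinearMap.range_toSpanSingleton, hM])
  have hy : ∀ y, L (σ y).1 + (σ y).2 • M v = y := fun y => by
    simpa using LinearMap.congr_fun hσ y
  let K : H →ₗ[ℂ] H := M ∘ₗ LinearMap.fst ℂ E ℂ ∘ₗ σ
  let B := Module.finBasis ℂ H
  have hc : Continuous fun t : ℂ => (1 + t • LinearMap.toMatrix B B K).det := by fun_prop
  have hdet : ∀ᶠ t in 𝓝 (0 : ℂ), (1 + t • LinearMap.toMatrix B B K).det ≠ 0 :=
    hc.continuousAt.eventually_ne (by simp)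
  filter_upwards [hdet.filter_mono nhdsWithin_le_nhds, self_mem_nhdsWithin] with t ht ht0
  have hu : IsUnit (1 + t • K) := by
    rw [← LinearMap.isUnit_toMatrix_iff B, Matrix.isUnit_iff_isUnit_det]
    simpa [LinearMap.toMatrix_one] using ht
  intro z
  obtain ⟨y, rfl⟩ := ((Module.End.isUnit_iff _).1 hu).2 z
  refine ⟨(σ y).1 + ((σ y).2 * t⁻¹) • v, ?_⟩
  have ht0' : t ≠ 0 := ht0
  have h1 : ((σ y).2 * t⁻¹) • t • M v = (σ y).2 • M v := by
    rw [smul_smul]; congr 1; field_simp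
  have h2 : L (σ y).1 = y - (σ y).2 • M v := eq_sub_of_add_eq (hy y)
  simp only [LinearMap.add_apply, LinearMap.smul_apply, map_add, map_smul, hL, smul_zero, smul_add,
    h1, h2, Module.End.one_apply, K, LinearMap.comp_apply, LinearMap.fst_apply]
  abel

theorem LinearMap.exists_sup_span_singleton_eq_top {K H : Type*} [Field K] [AddCommGroup H]
    [Module K H] {μ : H →ₗ[K] K} {W : Submodule K H} (h : LinearMap.ker μ ≤ W) :
    ∃ ξ, W ⊔ K ∙ ξ = ⊤ := by
  by_cases hμ : μ = 0
  · refine ⟨0, ?_⟩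
    rw [hμ, LinearMap.ker_zero] at h
    simp [top_le_iff.1 h]
  · obtain ⟨ξ, hξ⟩ := DFunLike.ne_iff.1 hμ
    have hξ' : μ ξ ≠ 0 := hξ
    refine ⟨ξ, eq_top_iff.2 fun y _ => ?_⟩
    rw [← sub_add_cancel y ((μ y / μ ξ) • ξ)]
    exact Submodule.add_mem_sup (h (by simp [hξ']))
      (Submodule.smul_mem _ _ (Submodule.mem_span_singleton_self ξ))

end LinearAlgebra

section ZariskiOpen

open Filter Topology

variable {Q : Quiv} {γ₁ γ₀ α : Q.V → ℕ} {P₁ : QRep Q γ₁} {P₀ : QRep Q γ₀} {X : QRep Q α}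
  {p : ∀ x, Matrix (Fin (α x)) (Fin (γ₀ x)) ℂ}
  {r : ∀ x, Matrix (Fin (γ₁ x)) (Fin (γ₀ x)) ℂ} {s : ∀ x, Matrix (Fin (γ₀ x)) (Fin (α x)) ℂ}

/-- Zariski open sets are open in the classical topology. -/
theorem zIsOpen.exists_isOpen {U : Set (QRep Q α)} (hU : zIsOpen U) :
    ∃ O : Set (RepCoord (Q := Q) α → ℂ), IsOpen O ∧ repCoords ⁻¹' O = U := by
  obtain ⟨O, hO, rfl⟩ := hU
  refine ⟨O, (?_ : Pi.topologicalSpace ≤ zarPi _) O hO, rfl⟩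
  refine le_generateFrom ?_
  rintro _ ⟨F, rfl⟩
  exact isOpen_ne_fun (MvPolynomial.continuous_eval F) continuous_const

theorem SplitSeq.eventually_cokerRep_mem {T : Type*} [TopologicalSpace T] {t₀ : T}
    {g : T → ∀ x, Matrix (Fin (γ₀ x)) (Fin (γ₁ x)) ℂ} (hg : ∀ x, Continuous fun t => g t x)
    (h : SplitSeq P₁ P₀ X (g t₀) p r s) {U : Set (QRep Q α)} (hU : zIsOpen U) (hX : X ∈ U) :
    ∀ᶠ t in 𝓝 t₀, (∀ x, (g t x * r x + s x * p x).det ≠ 0) ∧ cokerRep P₀ p r s (g t) ∈ U := by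
  have hG : ∀ x, Continuous fun t => g t x * r x + s x * p x := fun x => by
    have := hg x
    fun_prop
  have hdet : ∀ x, (g t₀ x * r x + s x * p x).det ≠ 0 := fun x => by simp [h.add_eq_one]
  refine (eventually_all.2 fun x => (hG x).matrix_det.continuousAt.eventually_ne (hdet x)).and ?_
  obtain ⟨O, hO, rfl⟩ := hU.exists_isOpen
  refine ContinuousAt.preimage_mem_nhds (f := fun t => repCoords (cokerRep P₀ p r s (g t))) ?_
    (hO.mem_nhds ?_)
  · have hinv : ∀ x, ContinuousAt (fun t => (g t x * r x + s x * p x)⁻¹) t₀ := fun x => by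
      simp only [Matrix.inv_def, Ring.inverse_eq_inv']
      exact ((hG x).matrix_det.continuousAt.inv₀ (hdet x)).smul
        (hG x).matrix_adjugate.continuousAt
    refine continuousAt_pi.2 fun c => ?_
    have h1 : ContinuousAt (fun t => cokerRep P₀ p r s (g t) c.1) t₀ := by
      have h2 := hinv (Q.h c.1)
      have h3 : Continuous fun B : Matrix (Fin (γ₀ (Q.h c.1))) (Fin (γ₀ (Q.h c.1))) ℂ =>
          p (Q.h c.1) * B * P₀ c.1 * s (Q.t c.1) := by fun_prop
      exact h3.continuousAt.comp h2
    exact continuousAt_pi.1 (continuousAt_pi.1 h1 c.2.1) c.2.2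
  · rw [h.cokerRep_self]
    exact hX

end ZariskiOpen

theorem Derivation.eval_eq_zero (δ : Derivation ℤ ℂ ℂ) {F : Polynomial ℂ} {z : ℂ}
    (hF : ∀ n, δ (F.coeff n) = 0) (hz : δ z = 0) : δ (F.eval z) = 0 := by
  rw [Polynomial.eval_eq_sum, Polynomial.sum_def, map_sum]
  refine Finset.sum_eq_zero fun n _ => ?_
  simp [Derivation.leibniz, Derivation.leibniz_pow, hF, hz]

section Generic

variable {Q : Quiv} {γ₁ γ₀ α : Q.V → ℕ} {P₁ : QRep Q γ₁} {P₀ : QRep Q γ₀} {X : QRep Q α}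
  {p : ∀ x, Matrix (Fin (α x)) (Fin (γ₀ x)) ℂ}
  {r : ∀ x, Matrix (Fin (γ₁ x)) (Fin (γ₀ x)) ℂ} {s : ∀ x, Matrix (Fin (γ₀ x)) (Fin (α x)) ℂ}
  {R : Set (FormalRel Q)}

/-- Over a tame algebra, every indecomposable module of dimension vector `α` is isomorphic to one
whose entries are algebraic expressions in a fixed countable set of constants and one parameter. -/
theorem IsTame.exists_countable [Fintype Q.A] (h : IsTame R) (α : Q.V → ℕ) :
    ∃ S : Set ℂ, S.Countable ∧ ∀ V ∈ modSet R α, IsIndecRep V →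
      ∃ (γ : Q.V → ℕ) (M : QRep Q γ) (z : ℂ), RIso M V ∧ ∀ δ : Derivation ℤ ℂ ℂ,
        (∀ s ∈ S, δ s = 0) → δ z = 0 → ∀ a, (M a).map δ = 0 := by
  obtain ⟨m, γs, M, -, n, βs, E, hME⟩ := h (∑ x, α x)
  refine ⟨(⋃ i, ⋃ a, ⋃ j, ⋃ k, Set.range (M i a j k).coeff) ∪
    ⋃ i, ⋃ a, ⋃ j, Set.range (E i a j), ?_, fun V hV hVi => ?_⟩
  · refine Set.Countable.union ?_ ?_
    · exact Set.countable_iUnion fun i => Set.countable_iUnion fun a => Set.countable_iUnion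
        fun j => Set.countable_iUnion fun k => Set.countable_range _
    · exact Set.countable_iUnion fun i => Set.countable_iUnion fun a => Set.countable_iUnion
        fun j => Set.countable_range _
  · rcases hME α V hV rfl hVi with ⟨k, hk⟩ | ⟨i, z, hi⟩
    · refine ⟨_, _, 0, hk, fun δ hδ _ a => ?_⟩
      ext j l
      exact hδ _ (Or.inr (by simp only [Set.mem_iUnion]; exact ⟨k, a, j, l, rfl⟩))
    · refine ⟨_, _, z, hi, fun δ hδ hz a => ?_⟩
      ext j l
      refine δ.eval_eq_zero (fun e => ?_) hz
      exact hδ _ (Or.inl (by simp only [Set.mem_iUnion]; exact ⟨i, a, j, l, e, rfl⟩))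

/-- Postcomposition with a morphism `g : M → N` of representations. -/
def postcompMap {γ δ ε : Q.V → ℕ} (L : QRep Q γ) (M : QRep Q δ) (N : QRep Q ε)
    (g : ∀ x : Q.V, Matrix (Fin (ε x)) (Fin (δ x)) ℂ) (hg : g ∈ HomS M N) :
    (HomS L M) →ₗ[ℂ] (HomS L N) where
  toFun φ := ⟨fun x => g x * φ.1 x, comp_mem_HomS hg φ.2⟩
  map_add' φ ψ := by
    apply Subtype.ext
    funext x
    simp [Matrix.mul_add]
  map_smul' c φ := by
    apply Subtype.ext
    funext x
    simp

/-- The tangent map `(a, b) ↦ a f + f b` has image of codimension at most one if `f` is generic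
with respect to a set of constants over which the cokernel of `f` is defined up to one parameter. -/
theorem SplitSeq.exists_sup_span_eq_top {ι : Type*} [Fintype ι]
    (B : Module.Basis ι ℂ (HomS P₁ P₀)) {f : HomS P₁ P₀}
    (h : SplitSeq P₁ P₀ X f.1 p r s) (h₀ : P₀ ∈ modSet R γ₀) (hp₀ : IsProjRep R P₀)
    {S : Set ℂ} (hP₀ : ∀ a i j, P₀ a i j ∈ S) (hB : ∀ k x i j, (B k).1 x i j ∈ S)
    (hf : ∀ v : ι → ℂ, ∃ δ : Derivation ℤ ℂ ℂ, (∀ s ∈ S, δ s = 0) ∧ ∀ k, δ (B.repr f k) = v k)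
    {γ : Q.V → ℕ} {M : QRep Q γ} {z : ℂ} (hM : RIso M X)
    (hMz : ∀ δ : Derivation ℤ ℂ ℂ, (∀ s ∈ S, δ s = 0) → δ z = 0 → ∀ a, (M a).map δ = 0) :
    ∃ ξ : HomS P₁ P₀, LinearMap.range ((precompMap P₁ P₀ P₀ f.1 f.2).coprod
      (postcompMap P₁ P₁ P₀ f.1 f.2)) ⊔ ℂ ∙ ξ = ⊤ := by
  classical
  have key : ∀ δ : Derivation ℤ ℂ ℂ, (∀ s ∈ S, δ s = 0) → δ z = 0 → ∀ y : HomS P₁ P₀,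
      (∀ k, δ (B.repr f k) = B.repr y k) → y ∈ LinearMap.range
        ((precompMap P₁ P₀ P₀ f.1 f.2).coprod (postcompMap P₁ P₁ P₀ f.1 f.2)) := by
    intro δ hS hz y hy
    have hfy : ∀ x, (f.1 x).map δ = y.1 x := by
      have hsum : ∀ (g : HomS P₁ P₀) x i j, g.1 x i j = ∑ k, B.repr g k * (B k).1 x i j := by
        intro g x i j
        conv_lhs => rw [← B.sum_repr g]
        rw [Submodule.coe_sum, Finset.sum_apply, Matrix.sum_apply]
        rfl
      intro x
      ext i j
      rw [Matrix.map_apply, hsum, hsum, map_sum]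
      refine Finset.sum_congr rfl fun k _ => ?_
      rw [Derivation.leibniz, hS _ (hB k x i j), hy]
      simp [mul_comm]
    obtain ⟨a, ha, b, hb, hab⟩ := h.exists_map_derivation_eq h₀ hp₀ δ hM (hMz δ hS hz)
      (fun a => by ext i j; exact hS _ (hP₀ a i j)) (by simp only [hfy]; exact y.2)
    refine ⟨(⟨a, ha⟩, ⟨b, hb⟩), Subtype.ext (funext fun x => ?_)⟩
    rw [← hfy, hab]
    rfl
  choose D hDS hD using fun k => hf (Pi.single k 1)
  let μ : HomS P₁ P₀ →ₗ[ℂ] ℂ := ∑ k, D k z • B.coord k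
  refine LinearMap.exists_sup_span_singleton_eq_top (μ := μ) fun y hy => ?_
  have happ : ∀ w, (∑ k, B.repr y k • D k) w = ∑ k, B.repr y k * D k w := fun w => by
    rw [← Derivation.coeFnAddMonoidHom_apply, map_sum, Finset.sum_apply]
    rfl
  refine key (∑ k, B.repr y k • D k) (fun w hw => ?_) ?_ y fun k => ?_
  · rw [happ]
    exact Finset.sum_eq_zero fun k _ => by rw [hDS k w hw, mul_zero]
  · rw [happ]
    simpa [μ, mul_comm] using hy
  · rw [happ]
    simp [hD, Pi.single_apply]

open Filter Topology

/-- If the tangent map at `f` has corank at most one, then moving `f` along a complement of its image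
gives a cokernel without extensions by the original one. -/
theorem SplitSeq.exists_dimExt1_eq_zero {f : HomS P₁ P₀} (h : SplitSeq P₁ P₀ X f.1 p r s)
    (h₀ : P₀ ∈ modSet R γ₀) (h₁ : P₁ ∈ modSet R γ₁) (hp₀ : IsProjRep R P₀) (hp₁ : IsProjRep R P₁)
    {ξ : HomS P₁ P₀} (hξ : LinearMap.range ((precompMap P₁ P₀ P₀ f.1 f.2).coprod
      (postcompMap P₁ P₁ P₀ f.1 f.2)) ⊔ ℂ ∙ ξ = ⊤) :
    ∃ Y ∈ PAset R α, dimExt1 R X Y = 0 := by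
  let v : HomS P₀ P₀ × HomS P₁ P₁ :=
    (-⟨fun x => 1, fun a => by simp⟩, ⟨fun x => 1, fun a => by simp⟩)
  have hξv : ((0 : _ →ₗ[ℂ] _).coprod (postcompMap P₁ P₁ P₀ ξ.1 ξ.2)) v = ξ := by
    apply Subtype.ext
    funext x
    simp [v, postcompMap]
  have hev := LinearMap.eventually_surjective_add_smul (v := v)
    (L := (precompMap P₁ P₀ P₀ f.1 f.2).coprod (postcompMap P₁ P₁ P₀ f.1 f.2))
    (M := (0 : _ →ₗ[ℂ] _).coprod (postcompMap P₁ P₁ P₀ ξ.1 ξ.2))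
    (by apply Subtype.ext; funext x; simp [v, precompMap, postcompMap])
    (by rw [hξv, hξ])
  have hdef := SplitSeq.eventually_cokerRep_mem (t₀ := (0 : ℂ)) (U := Set.univ)
    (g := fun t x => f.1 x + t • ξ.1 x) (fun x => by fun_prop) (by simpa using h)
    (@isOpen_univ _ (zarTop α)) trivial
  obtain ⟨t, ht, hdet, -⟩ := (hev.and (hdef.filter_mono nhdsWithin_le_nhds)).exists
  have hg : (fun x => f.1 x + t • ξ.1 x) ∈ HomS P₁ P₀ := (f + t • ξ).2
  have hY := h.deform hg hdet
  refine ⟨_, hY.mem_PAset h₀ h₁ hp₀ hp₁, SplitSeq.dimExt1_eq_zero_of_le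
    (h.Z1_le_B1 hY h₀ hp₀ hp₁ fun η hη => ?_)⟩
  obtain ⟨⟨a, b⟩, hab⟩ := ht ⟨η, hη⟩
  refine ⟨a.1, a.2, b.1, b.2, fun x => ?_⟩
  have := congrFun (congrArg Subtype.val hab) x
  refine this.symm.trans ?_
  simp [precompMap, postcompMap, Matrix.add_mul, add_assoc]

end Generic

/-- Let `A = ℂQ/⟨R⟩` be a connected, acyclic, tame bound quiver algebra
and `α` a dimension vector with `P_A(α) ≠ ∅`.  If `C(α)` (the closure of `P_A(α)`) is an
indecomposable irreducible component of `mod(A,α)`, then `ext¹_A(C(α),C(α)) = 0`. -/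
theorem statement3 (Q : Quiv) [Fintype Q.A] (hconn : QConnected Q) (hacyc : QAcyclic Q)
    (R : Set (FormalRel Q)) (hRfin : R.Finite) (hRadm : AdmissibleRels R)
    (htame : IsTame R)
    (α : Q.V → ℕ) (hne : (PAset R α).Nonempty)
    (hindec : IsIndecComp (Cset R α) (modSet R α)) :
    genExt1 R (Cset R α) (Cset R α) = 0 := by
  have hsub : PAset R α ⊆ Cset R α := @subset_closure _ (zarTop α) _
  obtain ⟨-, U, hU, hCU, hUind⟩ := hindec
  obtain ⟨X₀, hX₀, hX₀U⟩ : ((PAset R α) ∩ U).Nonempty := by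
    obtain ⟨V, hV⟩ := hne
    obtain ⟨V', hV'C, hV'U⟩ : (Cset R α ∩ U).Nonempty :=
      (@closure_nonempty_iff _ (zarTop α) _).1 ⟨V, hCU (hsub hV)⟩
    obtain ⟨W, hWU, hW⟩ := (@mem_closure_iff _ (zarTop α) _ _).1 hV'C U hU hV'U
    exact ⟨W, hW, hWU⟩
  obtain ⟨-, γ₀, γ₁, P₀, P₁, h₀, h₁, hp₀, hp₁, i, hi, p, hp, hinj, hsurj, hex⟩ := hX₀
  obtain ⟨r, s, h⟩ := SplitSeq.of_exact hi hp hinj hsurj hex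
  let B := Module.finBasis ℂ (HomS P₁ P₀)
  let g : (Fin (Module.finrank ℂ (HomS P₁ P₀)) → ℂ) → ∀ x, Matrix (Fin (γ₀ x)) (Fin (γ₁ x)) ℂ :=
    fun c x => (∑ k, c k • B k : HomS P₁ P₀).1 x
  have hgc : ∀ x, Continuous fun c => g c x := fun x => by
    simp only [g, Submodule.coe_sum, Submodule.coe_smul, Finset.sum_apply, Pi.smul_apply]
    fun_prop
  have hgi : g (B.repr ⟨i, hi⟩) = i := by
    funext x
    simp only [g, B.sum_repr]
  have hev := SplitSeq.eventually_cokerRep_mem (t₀ := (B.repr ⟨i, hi⟩ : _ → ℂ)) hgc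
    (by rw [hgi]; exact h) hU hX₀U
  obtain ⟨O, hO, hOo, hOc⟩ := eventually_nhds_iff.1 hev
  obtain ⟨S, hS, hSV⟩ := htame.exists_countable α
  let S' : Set ℂ := S ∪ ((⋃ a, ⋃ j, Set.range (P₀ a j)) ∪ ⋃ k, ⋃ x, ⋃ j, Set.range ((B k).1 x j))
  have hS' : S'.Countable := by
    refine hS.union (Set.Countable.union ?_ ?_)
    · exact Set.countable_iUnion fun a => Set.countable_iUnion fun j => Set.countable_range _
    · exact Set.countable_iUnion fun k => Set.countable_iUnion fun x => Set.countable_iUnion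
        fun j => Set.countable_range _
  obtain ⟨c, hcO, hc⟩ := exists_generic_point hS' hOo ⟨_, hOc⟩
  obtain ⟨hdet, hXU⟩ := hO c hcO
  let f : HomS P₁ P₀ := ∑ k, c k • B k
  have hX := h.deform (g := f.1) f.2 hdet
  have hXP := hX.mem_PAset h₀ h₁ hp₀ hp₁
  obtain ⟨γ, M, z, hM, hMz⟩ := hSV _ hXP.1 (hUind _ ⟨hsub hXP, hXU⟩)
  obtain ⟨ξ, hξ⟩ := hX.exists_sup_span_eq_top B h₀ hp₀ (S := S')
    (fun a j k => Or.inr (Or.inl (by simp only [Set.mem_iUnion]; exact ⟨a, j, k, rfl⟩)))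
    (fun k x j l => Or.inr (Or.inr (by simp only [Set.mem_iUnion]; exact ⟨k, x, j, l, rfl⟩)))
    (fun v => by simpa only [f, B.repr_sum_self] using hc v) hM
    (fun δ hδ hz => hMz δ (fun w hw => hδ w (Or.inl hw)) hz)
  obtain ⟨Y, hY, hXY⟩ := hX.exists_dimExt1_eq_zero h₀ h₁ hp₀ hp₁ hξ
  exact Nat.sInf_eq_zero.2 (Or.inl ⟨_, hsub hXP, Y, hsub hY, hXY.symm⟩)
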